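/- arXiv:1908.11110 — 4 statements merged into one kernel-verified Lean document; each statement's English description precedes it below -/
import Mathlib

section
/- Let V = V_n(q) with n ≥ 1 and q a power of a prime p, and let G be an affine permutation group of rank 3 on V with G_0 ≤ ΓL_n(q) and ⟨x⟩ \ {0} ⊆ x^{G_0} for some x ∈ V \ {0}. Let S = (V, 𝓛) be a G-affine proper partial linear space all of whose lines are affine F_p-subspaces of V. Then there exists a subfield F of F_q such that every line L ∈ 𝓛 containing 0 is an F-subspace of V with the property that F = {λ ∈ F_q : λu ∈ L} for every u ∈ L \ {0}. -/
open scoped Pointwise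

/-- A partial linear space on the point set `P`: a set of lines (subsets of `P`) such that
any two distinct points lie on at most one common line and every line has at least two
points. -/
structure PLS (P : Type*) where
  lines : Set (Set P)
  two_le_ncard : ∀ L ∈ lines, 2 ≤ L.ncard
  unique_of_pair : ∀ L₁ ∈ lines, ∀ L₂ ∈ lines, ∀ x y : P,
    x ≠ y → x ∈ L₁ → y ∈ L₁ → x ∈ L₂ → y ∈ L₂ → L₁ = L₂

namespace PLS

variable {P : Type*}

/-- Two points are collinear if they are distinct and lie on a common line. -/
def Collinear (S : PLS P) (x y : P) : Prop :=
  x ≠ y ∧ ∃ L ∈ S.lines, x ∈ L ∧ y ∈ L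

/-- The set of points collinear with `x`. -/
def nbrs (S : PLS P) (x : P) : Set P :=
  {y : P | S.Collinear x y}

/-- A linear space: any two distinct points lie on exactly one line. -/
def IsLinearSpace (S : PLS P) : Prop :=
  ∀ x y : P, x ≠ y → ∃! L, L ∈ S.lines ∧ x ∈ L ∧ y ∈ L

/-- A graph: every line has exactly two points. -/
def IsGraph (S : PLS P) : Prop :=
  ∀ L ∈ S.lines, L.ncard = 2

/-- Proper: neither a linear space nor a graph. -/
def IsProper (S : PLS P) : Prop :=
  ¬ S.IsLinearSpace ∧ ¬ S.IsGraph

/-- The automorphism group of `S`: all permutations of the point set mapping the line set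
onto itself. -/
def aut (S : PLS P) : Subgroup (Equiv.Perm P) :=
  MulAction.stabilizer (Equiv.Perm P) S.lines

end PLS

/-- The orbit of `x` under the stabiliser of `0` in `G`. -/
def zeroStabOrbit {V : Type*} [AddCommGroup V] (G : Subgroup (Equiv.Perm V)) (x : V) : Set V :=
  {y : V | ∃ g ∈ G, g 0 = 0 ∧ g x = y}

/-- `G` is an affine permutation group on `V`: it contains all translations, and every
element fixing `0` is additive. -/
def IsAffinePermGroup {V : Type*} [AddCommGroup V] (G : Subgroup (Equiv.Perm V)) : Prop :=
  (∀ v : V, Equiv.addRight v ∈ G) ∧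
    ∀ g ∈ G, g 0 = 0 → ∀ x y : V, g (x + y) = g x + g y

/-- The stabiliser of `0` in `G` has exactly two orbits on the set of nonzero vectors;
for an affine permutation group this says exactly that `G` has rank `3`. -/
def HasTwoZeroStabOrbits {V : Type*} [AddCommGroup V] (G : Subgroup (Equiv.Perm V)) : Prop :=
  ∃ x y : V, x ≠ 0 ∧ y ≠ 0 ∧ zeroStabOrbit G x ≠ zeroStabOrbit G y ∧
    ∀ z : V, z ≠ 0 → z ∈ zeroStabOrbit G x ∪ zeroStabOrbit G y

/-- The geometric sum `1 + Q + ⋯ + Q ^ (n - 1)`. -/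
def geomSum (Q n : ℕ) : ℕ := ∑ l ∈ Finset.range n, Q ^ l

theorem geomSum_one (Q : ℕ) : geomSum Q 1 = 1 := by simp [geomSum]

theorem geomSum_add (Q i j : ℕ) : geomSum Q (i + j) = geomSum Q i + Q ^ i * geomSum Q j := by
  simp [geomSum, Finset.sum_range_add, pow_add, Finset.mul_sum]

theorem geomSum_succ (Q n : ℕ) : geomSum Q (n + 1) = geomSum Q n + Q ^ n :=
  Finset.sum_range_succ _ _

theorem geomSum_mul_sub_one {Q : ℕ} (hQ : 1 ≤ Q) (n : ℕ) :
    geomSum Q n * (Q - 1) = Q ^ n - 1 := by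
  have h := geom_sum_mul (Q : ℤ) n
  have h1 : 1 ≤ Q ^ n := Nat.one_le_pow _ _ hQ
  zify [hQ, h1]
  simpa [geomSum] using h

theorem geomSum_mul (Q u n : ℕ) :
    geomSum Q (u * n) = geomSum Q u * geomSum (Q ^ u) n := by
  induction n with
  | zero => simp [geomSum]
  | succ n ih =>
    rw [Nat.mul_succ, geomSum_add, ih, geomSum_succ, ← pow_mul]
    ring

theorem geomSum_pos (Q : ℕ) {n : ℕ} (hn : 0 < n) : 0 < geomSum Q n := by
  obtain ⟨k, rfl⟩ := Nat.exists_eq_add_of_le' hn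
  rw [Nat.add_comm k, geomSum_add, geomSum_one]
  omega

/-- A set of natural numbers closed under addition and under differences, and containing a
positive element, consists of the multiples of a positive number. -/
theorem exists_forall_iff_dvd {Z : ℕ → Prop} (hpos : ∃ n, 0 < n ∧ Z n)
    (hadd : ∀ i j, Z i → Z j → Z (i + j)) (hsub : ∀ i j, Z i → Z (i + j) → Z j) :
    ∃ d, 0 < d ∧ ∀ n, Z n ↔ d ∣ n := by
  classical
  obtain ⟨hd, hZd⟩ := Nat.find_spec hpos
  set d := Nat.find hpos with hdef
  have hmul : ∀ k, Z (d * k) := by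
    intro k
    induction k with
    | zero => exact hsub d 0 hZd hZd
    | succ k ih => exact hadd _ _ ih hZd
  refine ⟨d, hd, fun n => ⟨fun hn => ?_, ?_⟩⟩
  · have hr : Z (n % d) := hsub (d * (n / d)) _ (hmul _) (by rwa [Nat.div_add_mod])
    by_contra hnd
    have hlt := Nat.mod_lt n hd
    exact Nat.find_min hpos hlt ⟨Nat.pos_of_ne_zero fun h => hnd (Nat.dvd_of_mod_eq_zero h), hr⟩
  · rintro ⟨k, rfl⟩
    exact hmul k

theorem coprime_of_forall_exists_modEq {M β : ℕ} {f : ℕ → ℕ}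
    (hsurj : ∀ x, ∃ n, x ≡ β * f n [MOD M]) : β.Coprime M := by
  obtain ⟨n, hn⟩ := hsurj 1
  have h1 : M.Coprime (β * f n) := by
    rw [Nat.Coprime, Nat.gcd_comm, ← hn.gcd_eq, Nat.gcd_one_left]
  exact (Nat.Coprime.coprime_mul_right_right h1).symm

/-- If the geometric sums to base `Q`, up to a factor `β`, represent all residues modulo `M`,
then divisibility of `geomSum Q i` by a divisor `d` of `M` is divisibility of `i` by `d`. -/
theorem dvd_geomSum_iff {Q M β d : ℕ} (hM : 0 < M) (hQ : Q.Coprime M)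
    (hsurj : ∀ x, ∃ n, x ≡ β * geomSum Q n [MOD M]) (hd : d ∣ M) (i : ℕ) :
    d ∣ geomSum Q i ↔ d ∣ i := by
  have hd0 : 0 < d := Nat.pos_of_dvd_of_pos hd hM
  have hQd : Q.Coprime d := hQ.coprime_dvd_right hd
  have hβ : β.Coprime d := (coprime_of_forall_exists_modEq hsurj).coprime_dvd_right hd
  have hsurj' : ∀ x, ∃ n, x ≡ geomSum Q n [MOD d] := by
    intro x
    obtain ⟨n, hn⟩ := hsurj (β * x)
    exact ⟨n, (hn.of_dvd hd).cancel_left_of_coprime hβ.symm⟩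
  have hcancel : ∀ i j, geomSum Q i ≡ geomSum Q (i + j) [MOD d] → d ∣ geomSum Q j := by
    intro i j h
    rw [geomSum_add] at h
    have h2 : d ∣ Q ^ i * geomSum Q j := by
      have := (Nat.modEq_iff_dvd' (Nat.le_add_right _ _)).1 h
      simpa using this
    exact (Nat.Coprime.dvd_of_dvd_mul_left (hQd.pow_left i).symm h2)
  have hpigeon : ∃ n, 0 < n ∧ n ≤ d ∧ d ∣ geomSum Q n := by
    obtain ⟨a, ha, b, hb, hab, hf⟩ := Finset.exists_ne_map_eq_of_card_lt_of_maps_to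
      (s := Finset.range (d + 1)) (t := Finset.range d) (f := fun n => geomSum Q n % d)
      (by simp) (fun n _ => by simpa using Nat.mod_lt _ hd0)
    simp only [Finset.mem_range] at ha hb
    rcases Nat.lt_or_gt_of_ne hab with h | h
    · obtain ⟨k, rfl⟩ := Nat.exists_eq_add_of_lt h
      exact ⟨k + 1, by omega, by omega, hcancel a (k + 1) hf⟩
    · obtain ⟨k, rfl⟩ := Nat.exists_eq_add_of_lt h
      exact ⟨k + 1, by omega, by omega, hcancel b (k + 1) hf.symm⟩
  obtain ⟨n, hn0, hnd, hn⟩ := hpigeon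
  obtain ⟨c, hc0, hc⟩ := exists_forall_iff_dvd (Z := fun i => d ∣ geomSum Q i) ⟨n, hn0, hn⟩
    (fun i j hi hj => by
      rw [geomSum_add]; exact dvd_add hi (hj.mul_left _))
    (fun i j hi hij => by
      rw [geomSum_add, Nat.dvd_add_right hi] at hij
      exact (Nat.Coprime.dvd_of_dvd_mul_left (hQd.pow_left i).symm hij))
  have hcd : c ≤ d := (Nat.le_of_dvd hn0 ((hc n).1 hn)).trans hnd
  have hdc : d ≤ c := by
    have hsub : Finset.range d ⊆ (Finset.range c).image fun n => geomSum Q n % d := by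
      intro x hx
      obtain ⟨k, hk⟩ := hsurj' x
      refine Finset.mem_image.2 ⟨k % c, Finset.mem_range.2 (Nat.mod_lt _ hc0), ?_⟩
      have h1 : geomSum Q (c * (k / c) + k % c) ≡ geomSum Q (k % c) [MOD d] := by
        have h0 : d ∣ geomSum Q (c * (k / c)) := (hc _).2 (dvd_mul_right _ _)
        have hQc : Q ^ (c * (k / c)) ≡ 1 [MOD d] := by
          rcases Nat.eq_zero_or_pos Q with rfl | hQ0
          · have : d = 1 := by simpa using hQd
            rw [this]; exact Nat.modEq_one
          · refine ((Nat.modEq_iff_dvd' (Nat.one_le_pow _ _ hQ0)).2 ?_).symm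
            rw [← geomSum_mul_sub_one hQ0]
            exact h0.mul_right _
        rw [geomSum_add]
        simpa using ((Nat.modEq_zero_iff_dvd.2 h0).add (hQc.mul_right (geomSum Q (k % c))))
      rw [Nat.div_add_mod] at h1
      have h2 : geomSum Q (k % c) % d = x % d := (hk.trans h1).symm
      rw [h2, Nat.mod_eq_of_lt (Finset.mem_range.1 hx)]
    simpa using (Finset.card_le_card hsub).trans Finset.card_image_le
  rw [hc i, le_antisymm hcd hdc]

theorem mul_geomSum_modEq_iff {Q M α β u : ℕ} (hM : 0 < M) (hQ : Q.Coprime M)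
    (hsurj : ∀ x, ∃ n, x ≡ β * geomSum Q n [MOD M]) (hα : α ≡ β * geomSum Q u [MOD M])
    (i j : ℕ) :
    α * geomSum (Q ^ u) i ≡ α * geomSum (Q ^ u) j [MOD M] ↔ i ≡ j [MOD M / M.gcd u] := by
  have hβ : M.gcd β = 1 := (coprime_of_forall_exists_modEq hsurj).symm
  have hle : ∀ a b, a ≤ b → (geomSum Q a ≡ geomSum Q b [MOD M] ↔ a ≡ b [MOD M]) := by
    intro a b hab
    obtain ⟨c, rfl⟩ := Nat.exists_eq_add_of_le hab
    rw [geomSum_add, Nat.modEq_iff_dvd' (Nat.le_add_right _ _), Nat.modEq_iff_dvd' hab,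
      Nat.add_sub_cancel_left, Nat.add_sub_cancel_left,
      Nat.Coprime.dvd_mul_left (hQ.pow_left a).symm, dvd_geomSum_iff hM hQ hsurj dvd_rfl]
  have hS : ∀ a b, geomSum Q a ≡ geomSum Q b [MOD M] ↔ a ≡ b [MOD M] := by
    intro a b
    rcases le_total a b with h | h
    · exact hle a b h
    · rw [Nat.ModEq.comm, hle b a h, Nat.ModEq.comm]
  have hαS : ∀ n, α * geomSum (Q ^ u) n ≡ β * geomSum Q (u * n) [MOD M] := by
    intro n
    rw [geomSum_mul, ← mul_assoc]
    exact hα.mul_right _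
  have hu : α * geomSum (Q ^ u) i ≡ α * geomSum (Q ^ u) j [MOD M] ↔ u * i ≡ u * j [MOD M] := by
    rw [← hS (u * i) (u * j)]
    constructor
    · intro h
      exact (((hαS i).symm.trans h).trans (hαS j)).cancel_left_of_coprime hβ
    · intro h
      exact ((hαS i).trans (h.mul_left β)).trans (hαS j).symm
  rw [hu]
  constructor
  · exact Nat.ModEq.cancel_left_div_gcd hM
  · intro h
    refine (h.mul_left' u).of_dvd ?_
    calc M = M.gcd u * (M / M.gcd u) := (Nat.mul_div_cancel' (Nat.gcd_dvd_left _ _)).symm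
      _ ∣ u * (M / M.gcd u) := Nat.mul_dvd_mul_right (Nat.gcd_dvd_right _ _) _

theorem sq_lt_two_pow_succ (n : ℕ) : n ^ 2 < 2 ^ (n + 1) := by
  induction n with
  | zero => simp
  | succ n ih =>
    rcases Nat.lt_or_ge n 3 with h | h
    · interval_cases n <;> norm_num
    · have : 2 ^ (n + 1 + 1) = 2 * 2 ^ (n + 1) := by ring
      nlinarith

/-- Two competing bounds on the size `p ^ m` of a vector space over a field with `κ`
elements. -/
theorem false_of_sq_le_of_sub_one_le {p m κ w : ℕ} (hp : 2 ≤ p) (hκ : 2 ≤ κ)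
    (hwm : w ≤ m) (hsq : κ ^ 2 ≤ p ^ m) (hle : p ^ m - 1 ≤ (κ - 1) * w) : False := by
  obtain ⟨k, rfl⟩ := Nat.exists_eq_add_of_le' hκ
  have h0 : p ^ m ≤ (k + 1) * m + 1 := by
    have : (k + 2 - 1) * w ≤ (k + 1) * m := Nat.mul_le_mul (by omega) hwm
    omega
  have h1 : k + 3 ≤ m := by
    by_contra! h
    nlinarith
  obtain ⟨j, rfl⟩ := Nat.exists_eq_add_of_le' h1
  have h2 := sq_lt_two_pow_succ (j + k + 2)
  have h3 : 2 ^ (j + k + 2 + 1) ≤ p ^ (j + (k + 3)) := Nat.pow_le_pow_left hp _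
  nlinarith

/-- The arithmetic heart of the counting argument: the index `N = M / gcd(M, u)` divides `m`. -/
theorem index_dvd_of_norm_condition {p s u m M β α N h : ℕ} (hp : p.Prime) (hs : 0 < s)
    (hu : 0 < u) (hm : 0 < m) (hM : 0 < M) (hpM : p.Coprime M)
    (hsurj : ∀ x, ∃ n, x ≡ β * geomSum (p ^ s) n [MOD M])
    (hα : α ≡ β * geomSum (p ^ s) u [MOD M])
    (hnorm : (p ^ s) ^ u - 1 ∣ α * h)
    (hN : N = M / M.gcd u) (hcount : p ^ m - 1 = h * N) : N ∣ m := by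
  have hQM : (p ^ s).Coprime M := hpM.pow_left s
  have hdvd {d : ℕ} (hd : d ∣ M) (i : ℕ) : d ∣ geomSum (p ^ s) i ↔ d ∣ i :=
    dvd_geomSum_iff hM hQM hsurj hd i
  have hNM : N ∣ M := hN ▸ Nat.div_dvd_of_dvd (Nat.gcd_dvd_left _ _)
  have hgN : M.gcd u * N = M := hN ▸ Nat.mul_div_cancel' (Nat.gcd_dvd_left _ _)
  have hpm : 1 < p ^ m := Nat.one_lt_pow hm.ne' hp.one_lt
  have hps : 1 < p ^ s := Nat.one_lt_pow hs.ne' hp.one_lt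
  have hN0 : N ≠ 0 := by rintro rfl; omega
  have hh0 : h ≠ 0 := by rintro rfl; omega
  rw [← hdvd hNM, ← Nat.factorization_prime_le_iff_dvd hN0 (geomSum_pos _ hm).ne']
  intro r hr
  by_cases hrN : r ∣ N
  swap
  · rw [Nat.factorization_eq_zero_of_not_dvd hrN]; exact Nat.zero_le _
  have hrM := hrN.trans hNM
  -- the `r`-part of `M` does not divide `u`
  set v := (geomSum (p ^ s) u).factorization r with hv
  have hSu0 := (geomSum_pos (p ^ s) hu).ne'
  have hvM : v < M.factorization r := by
    by_contra! hle
    have h1 : r ^ M.factorization r ∣ geomSum (p ^ s) u :=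
      (hr.pow_dvd_iff_le_factorization hSu0).2 hle
    have h2 := (hdvd (Nat.ordProj_dvd M r) u).1 h1
    have h3 : r ^ M.factorization r ∣ M.gcd u := Nat.dvd_gcd (Nat.ordProj_dvd M r) h2
    have h4 : r ^ (M.factorization r + 1) ∣ M := by
      rw [pow_succ]
      exact (Nat.mul_dvd_mul h3 hrN).trans hgN.dvd
    exact Nat.pow_succ_factorization_not_dvd hM.ne' hr h4
  have hrv : r ^ (v + 1) ∣ M :=
    (hr.pow_dvd_iff_le_factorization hM.ne').2 hvM
  have hrβ : ¬ r ∣ β := by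
    intro hrβ
    exact hr.one_lt.ne'
      (Nat.dvd_one.1 ((coprime_of_forall_exists_modEq hsurj) ▸ Nat.dvd_gcd hrβ hrM))
  have hαv : ¬ r ^ (v + 1) ∣ α := by
    intro h1
    have h2 : r ^ (v + 1) ∣ β * geomSum (p ^ s) u := ((hα.of_dvd hrv).dvd_iff dvd_rfl).1 h1
    have h3 := Nat.Coprime.dvd_of_dvd_mul_left
      (((Nat.Prime.coprime_iff_not_dvd hr).2 hrβ).pow_left (v + 1)) h2
    exact Nat.pow_succ_factorization_not_dvd hSu0 hr h3
  have hα0 : α ≠ 0 := by rintro rfl; simp at hαv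
  have hαf : α.factorization r ≤ v := by
    by_contra! hlt
    exact hαv ((hr.pow_dvd_iff_le_factorization hα0).2 hlt)
  have hps1 : p ^ s - 1 ≠ 0 := by omega
  have e1 : v + (p ^ s - 1).factorization r ≤ α.factorization r + h.factorization r := by
    have := (Nat.factorization_prime_le_iff_dvd
      (by rw [← geomSum_mul_sub_one hps.le]; exact mul_ne_zero hSu0 hps1)
      (mul_ne_zero hα0 hh0)).2 hnorm r hr
    rwa [← geomSum_mul_sub_one hps.le, Nat.factorization_mul hSu0 hps1,
      Nat.factorization_mul hα0 hh0] at this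
  have e2 : h.factorization r + N.factorization r
      ≤ (geomSum (p ^ s) m).factorization r + (p ^ s - 1).factorization r := by
    have hSm0 := (geomSum_pos (p ^ s) hm).ne'
    have hd : h * N ∣ geomSum (p ^ s) m * (p ^ s - 1) := by
      rw [← hcount, geomSum_mul_sub_one hps.le, ← pow_mul, mul_comm s m, pow_mul]
      simpa using Nat.sub_dvd_pow_sub_pow (p ^ m) 1 s
    have := (Nat.factorization_prime_le_iff_dvd (mul_ne_zero hh0 hN0)
      (mul_ne_zero hSm0 hps1)).2 hd r hr
    rwa [Nat.factorization_mul hh0 hN0, Nat.factorization_mul hSm0 hps1] at this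
  omega

theorem card_units_mem {F : Type*} [Field F] [Finite F] {A : Set F} (h0 : (0 : F) ∈ A) :
    Nat.card {x : Fˣ // (x : F) ∈ A} = A.ncard - 1 := by
  rw [← Set.ncard_sdiff_singleton_of_mem h0]
  have h : ((fun x : Fˣ => (x : F)) '' {x : Fˣ | (x : F) ∈ A}) = A \ {0} := by
    ext a
    constructor
    · rintro ⟨x, hx, rfl⟩
      exact ⟨hx, x.ne_zero⟩
    · rintro ⟨ha, ha0⟩
      exact ⟨Units.mk0 a ha0, ha, rfl⟩
  rw [← h, Set.ncard_image_of_injective _ Units.val_injective]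
  rfl

/-- An additive subgroup containing `1` with nontrivial multiples by elements outside its
multiplier ring is at least as large as the square of that ring. -/
theorem exists_multiplier_bound {F : Type*} [Field F] [Finite F] {A : AddSubgroup F}
    (h1A : (1 : F) ∈ A) {x y : F} (hx : x ∈ A) (hy : y ∈ A) (hxy : x * y ∉ A) :
    ({c : F | ∀ a ∈ A, c * a ∈ A}).ncard ^ 2 ≤ Nat.card A := by
  set K : Set F := {c : F | ∀ a ∈ A, c * a ∈ A} with hK
  have hKA : ∀ c ∈ K, c ∈ A := fun c hc => by simpa using hc 1 h1A
  have hsub : ∀ c ∈ K, ∀ d ∈ K, c - d ∈ K := fun c hc d hd a ha => by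
    rw [sub_mul]; exact A.sub_mem (hc a ha) (hd a ha)
  have hmul : ∀ c ∈ K, ∀ d ∈ K, c * d ∈ K := fun c hc d hd a ha => by
    rw [mul_assoc]; exact hc _ (hd a ha)
  have hpow : ∀ c ∈ K, ∀ n : ℕ, c ^ n ∈ K := fun c hc n => by
    induction n with
    | zero => intro a ha; simpa using ha
    | succ n ih => rw [pow_succ]; exact hmul _ ih _ hc
  have hinv : ∀ c ∈ K, c ≠ 0 → c⁻¹ ∈ K := fun c hc hc0 => by
    obtain ⟨n, hn⟩ : ∃ n, Nat.card Fˣ = n + 1 := Nat.exists_eq_add_of_le' Nat.card_pos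
    have h1 : (Units.mk0 c hc0) ^ (n + 1) = 1 := by rw [← hn]; exact pow_card_eq_one'
    have h2 : c ^ n * c = 1 := by
      rw [← pow_succ]
      simpa using congrArg Units.val h1
    rw [← eq_inv_of_mul_eq_one_left h2]
    exact hpow c hc n
  have hxK : x ∉ K := fun h => hxy (h y hy)
  let f : K × K → A := fun q => ⟨q.1 + q.2 * x, A.add_mem (hKA _ q.1.2) (q.2.2 x hx)⟩
  have hf : Function.Injective f := by
    rintro ⟨⟨a, ha⟩, ⟨b, hb⟩⟩ ⟨⟨c, hc⟩, ⟨d, hd⟩⟩ h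
    have h' : a + b * x = c + d * x := congrArg Subtype.val h
    have hbd : b = d := by
      by_contra hne
      apply hxK
      have hne' : b - d ≠ 0 := sub_ne_zero.2 hne
      have hxe : x = (b - d)⁻¹ * (c - a) := by
        rw [eq_inv_mul_iff_mul_eq₀ hne']
        linear_combination h'
      rw [hxe]
      exact hmul _ (hinv _ (hsub _ hb _ hd) hne') _ (hsub _ hc _ ha)
    subst hbd
    have hac : a = c := by linear_combination h'
    subst hac
    rfl
  have := Nat.card_le_card_of_injective f hf
  rwa [Nat.card_prod, ← sq, Nat.card_coe_set_eq] at this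

/-- Let `T c i` say that `z ↦ c * z ^ (p ^ i)` lies in a group of semilinear permutations of the
one-dimensional space `F`, transitive on the nonzero vectors, and let `A` be the member through `1`
of an invariant partition of the nonzero vectors into additive subgroups. Then `A` is closed under
multiplication. -/
theorem mul_mem_of_transitive_semilinear {F : Type*} [Field F] [Finite F] {p e : ℕ}
    (hp : p.Prime) (hcard : Nat.card F = p ^ e) (T : Fˣ → ℕ → Prop)
    (hmul : ∀ c d i j, T c i → T d j → T (c * d ^ p ^ i) (i + j))
    (hleft : ∀ c d i j, T c i → T (c * d ^ p ^ i) (i + j) → T d j)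
    (hright : ∀ c d i, T c i → T (d * c) i → T d 0)
    (hone : T 1 e) (htrans : ∀ c, ∃ i, T c i)
    (A : AddSubgroup F) (h1A : (1 : F) ∈ A)
    (hA : ∀ c i (x : Fˣ), T c i → (x : F) ∈ A → (((c * x ^ p ^ i : Fˣ) : F) ∈ A ↔ (c : F) ∈ A))
    (hA' : ∀ c i (x : Fˣ), T c i → (c : F) ∈ A → ((c * x ^ p ^ i : Fˣ) : F) ∈ A → (x : F) ∈ A)
    {x y : F} (hx : x ∈ A) (hy : y ∈ A) : x * y ∈ A := by
  by_contra hxy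
  have he : 0 < e := by
    rcases Nat.eq_zero_or_pos e with rfl | h
    · have h1 := Finite.one_lt_card (α := F)
      rw [hcard, pow_zero] at h1
      exact absurd h1 (lt_irrefl 1)
    · exact h
  have hcardU : Nat.card Fˣ = p ^ e - 1 := by rw [Nat.card_units, hcard]
  have hcop : p.Coprime (p ^ e - 1) := (Nat.Prime.coprime_iff_not_dvd hp).2 fun h => by
    have h1 : 1 ≤ p ^ e := Nat.one_le_pow _ _ hp.pos
    have h2 := (Nat.dvd_sub_iff_right h1 (dvd_pow_self p he.ne')).1 h
    exact hp.one_lt.ne' (Nat.dvd_one.1 h2)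
  have hfrob : ∀ c : Fˣ, c ^ p ^ e = c := fun c => by
    have h1 : p ^ e = Nat.card Fˣ + 1 := by
      have := Nat.one_le_pow e p hp.pos
      omega
    rw [h1, pow_succ, pow_card_eq_one', one_mul]
  have h10 : T 1 0 := hleft 1 1 e 0 hone (by simpa using hone)
  have hpow : ∀ (i : ℕ) (c : Fˣ), ∃ d : Fˣ, d ^ p ^ i = c := by
    intro i c
    have hco : (Nat.card Fˣ).Coprime (p ^ i) := by
      rw [hcardU]
      exact Nat.Coprime.pow_right i hcop.symm
    exact (powCoprime hco).surjective c
  -- the exponents that occur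
  obtain ⟨s, hs, hTs⟩ := exists_forall_iff_dvd (Z := fun i => ∃ c, T c i) ⟨e, he, 1, hone⟩
    (fun i j ⟨c, hc⟩ ⟨d, hd⟩ => ⟨_, hmul c d i j hc hd⟩)
    (fun i j ⟨c, hc⟩ ⟨d, hd⟩ => by
      obtain ⟨d', hd'⟩ := hpow i (c⁻¹ * d)
      exact ⟨d', hleft c d' i j hc (by rwa [hd', mul_inv_cancel_left])⟩)
  -- the exponents that occur in the stabiliser of `A`
  obtain ⟨t, ht, hTt⟩ := exists_forall_iff_dvd (Z := fun i => ∃ c : Fˣ, T c i ∧ (c : F) ∈ A)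
    ⟨e, he, 1, hone, by simpa using h1A⟩
    (fun i j ⟨c, hc, hcA⟩ ⟨d, hd, hdA⟩ =>
      ⟨_, hmul c d i j hc hd, (hA c i d hc hdA).2 hcA⟩)
    (fun i j ⟨c, hc, hcA⟩ ⟨d, hd, hdA⟩ => by
      obtain ⟨d', hd'⟩ := hpow i (c⁻¹ * d)
      have hd'' : c * d' ^ p ^ i = d := by rw [hd', mul_inv_cancel_left]
      exact ⟨d', hleft c d' i j hc (by rwa [hd'']), hA' c i d' hc hcA (by rwa [hd''])⟩)
  obtain ⟨b, hb⟩ := (hTs s).2 dvd_rfl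
  obtain ⟨a, ha, haA⟩ := (hTt t).2 dvd_rfl
  obtain ⟨u, rfl⟩ := (hTs t).1 ⟨a, ha⟩
  have hu : 0 < u := Nat.pos_of_mul_pos_left ht
  have hiter : ∀ c i n, T c i → T (c ^ geomSum (p ^ i) n) (i * n) := by
    intro c i n hc
    induction n with
    | zero => simpa [geomSum] using h10
    | succ n ih =>
      have := hmul _ _ _ _ ih hc
      rwa [← pow_add, pow_mul, ← geomSum_succ] at this
  have haiter : ∀ n, ((a ^ geomSum (p ^ (s * u)) n : Fˣ) : F) ∈ A := by
    intro n
    induction n with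
    | zero => simpa [geomSum] using h1A
    | succ n ih =>
      have := (hA _ _ _ (hiter a (s * u) n ha) haA).2 ih
      rwa [← pow_add, pow_mul p (s * u) n, ← geomSum_succ] at this
  -- the scalars, and the scalars preserving `A`
  let T₀ : Subgroup Fˣ :=
    { carrier := {c | T c 0}
      one_mem' := h10
      mul_mem' := fun {c d} hc hd => by simpa using hmul c d 0 0 hc hd
      inv_mem' := fun {c} hc => hleft c c⁻¹ 0 0 hc (by simpa using h10) }
  have hT₀ : ∀ c, c ∈ T₀ ↔ T c 0 := fun c => Iff.rfl
  let H : Subgroup Fˣ :=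
    { carrier := {c | T c 0 ∧ (c : F) ∈ A}
      one_mem' := ⟨h10, by simpa using h1A⟩
      mul_mem' := fun {c d} hc hd => ⟨T₀.mul_mem hc.1 hd.1, by
        simpa using (hA c 0 d hc.1 hd.2).2 hc.2⟩
      inv_mem' := fun {c} hc => ⟨T₀.inv_mem hc.1, by
        simpa [h1A] using hA c⁻¹ 0 c (T₀.inv_mem hc.1) hc.2⟩ }
  have hdiv : ∀ c d : Fˣ, (c : F) ∈ A → (d : F) ∈ A → c * d⁻¹ ∈ T₀ → c * d⁻¹ ∈ H :=
    fun c d hc hd h => ⟨h, (hA (c * d⁻¹) 0 d h hd).1 (by simpa using hc)⟩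
  obtain ⟨g, hg⟩ := IsCyclic.exists_monoid_generator (α := Fˣ)
  have hgord : orderOf g = p ^ e - 1 := by
    rw [orderOf_eq_card_of_forall_mem_powers hg, hcardU]
  obtain ⟨M, hM, hTM⟩ := exists_forall_iff_dvd (Z := fun i => g ^ i ∈ T₀)
    ⟨orderOf g, orderOf_pos g, by simp [pow_orderOf_eq_one, T₀.one_mem]⟩
    (fun i j hi hj => by rw [pow_add]; exact T₀.mul_mem hi hj)
    (fun i j hi hij => by rwa [pow_add, T₀.mul_mem_cancel_left hi] at hij)
  have hlog : ∀ i j, g ^ i * (g ^ j)⁻¹ ∈ T₀ ↔ i ≡ j [MOD M] := by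
    intro i j
    rcases le_total i j with h | h
    · rw [Nat.modEq_iff_dvd' h, ← hTM, ← T₀.inv_mem_iff, pow_sub _ h, mul_inv_rev, inv_inv]
    · rw [Nat.ModEq.comm, Nat.modEq_iff_dvd' h, ← hTM, pow_sub _ h]
  have hpM : p.Coprime M := by
    refine hcop.coprime_dvd_right ((hTM _).1 ?_)
    rw [← hgord, pow_orderOf_eq_one]
    exact T₀.one_mem
  obtain ⟨β, rfl⟩ := hg b
  obtain ⟨α, rfl⟩ := hg a
  simp only at hb ha haA haiter
  have hexp : ∀ i n, T (g ^ i) (s * n) → i ≡ β * geomSum (p ^ s) n [MOD M] := by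
    intro i n h
    rw [← hlog, hT₀, pow_mul]
    exact hright _ _ _ (hiter _ s n hb) (by simpa using h)
  have hsurj : ∀ i, ∃ n, i ≡ β * geomSum (p ^ s) n [MOD M] := by
    intro i
    obtain ⟨j, hj⟩ := htrans (g ^ i)
    obtain ⟨n, rfl⟩ := (hTs j).1 ⟨_, hj⟩
    exact ⟨n, hexp i n hj⟩
  have hα := hexp α u ha
  have hnorm : (p ^ s) ^ u - 1 ∣ α * Nat.card H := by
    obtain ⟨n, hn⟩ := (hTt e).1 ⟨1, hone, by simpa using h1A⟩
    have hn0 : 0 < n := Nat.pos_of_ne_zero (by rintro rfl; omega)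
    set S := geomSum (p ^ (s * u)) n with hS
    have hν : (g ^ α) ^ S ∈ H := by
      refine ⟨hleft 1 _ e 0 hone ?_, haiter n⟩
      have := hiter _ _ n ha
      rw [← hn] at this
      rwa [hfrob, one_mul, add_zero]
    have h1 : ((g ^ α) ^ S) ^ Nat.card H = 1 := by
      exact congrArg Subtype.val (pow_card_eq_one' (x := (⟨_, hν⟩ : H)))
    rw [← pow_mul, ← pow_mul, ← orderOf_dvd_iff_pow_eq_one, hgord, hn, pow_mul p (s * u),
      ← geomSum_mul_sub_one (Nat.one_le_pow _ _ hp.pos), ← hS, pow_mul p s u,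
      mul_left_comm α S] at h1
    exact Nat.dvd_of_mul_dvd_mul_left (geomSum_pos _ hn0) h1
  obtain ⟨m, -, hm⟩ : ∃ m ≤ e, Nat.card A = p ^ m :=
    (Nat.dvd_prime_pow hp).1 (hcard ▸ A.card_addSubgroup_dvd_card)
  have hm0 : 0 < m := by
    rcases Nat.eq_zero_or_pos m with rfl | h
    · have : Nontrivial A := ⟨⟨0, ⟨1, h1A⟩, fun h => zero_ne_one (congrArg Subtype.val h)⟩⟩
      have h1 := Finite.one_lt_card (α := A)
      rw [hm, pow_zero] at h1
      exact absurd h1 (lt_irrefl 1)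
    · exact h
  set N := M / M.gcd u with hN
  have hgN : M.gcd u * N = M := Nat.mul_div_cancel' (Nat.gcd_dvd_left _ _)
  have hN0 : 0 < N := Nat.pos_of_ne_zero (by intro h; rw [h] at hgN; omega)
  have hαn : ∀ i j, α * geomSum (p ^ (s * u)) i ≡ α * geomSum (p ^ (s * u)) j [MOD M] ↔
      i ≡ j [MOD N] := by
    intro i j
    rw [pow_mul p s u]
    exact mul_geomSum_modEq_iff hM (hpM.pow_left s) hsurj hα i j
  have hcount : p ^ m - 1 = Nat.card H * N := by
    rw [← hm, ← Nat.card_fin N, ← Nat.card_prod]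
    have h1 := card_units_mem (A := (A : Set F)) A.zero_mem
    rw [← Nat.card_coe_set_eq] at h1
    refine h1.symm.trans (Nat.card_congr (Equiv.ofBijective (fun q : H × Fin N =>
      (⟨q.1 * (g ^ α) ^ geomSum (p ^ (s * u)) q.2, ?_⟩ : {x : Fˣ // (x : F) ∈ A})) ⟨?_, ?_⟩)).symm
    · have := (hA q.1 0 _ q.1.2.1 (haiter q.2)).2 q.1.2.2
      simpa using this
    · rintro ⟨⟨h, hh⟩, i⟩ ⟨⟨k, hk⟩, j⟩ heq
      have h2 : h * (g ^ α) ^ geomSum (p ^ (s * u)) i = k * (g ^ α) ^ geomSum (p ^ (s * u)) j :=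
        congrArg Subtype.val heq
      have h3 : i = j := by
        have h4 := (hαn i j).1 ((hlog _ _).1 (by
          rw [pow_mul g, pow_mul g, show (g ^ α) ^ geomSum (p ^ (s * u)) i *
            ((g ^ α) ^ geomSum (p ^ (s * u)) j)⁻¹ = h⁻¹ * k by
              rw [eq_inv_mul_iff_mul_eq, ← mul_assoc, h2, mul_inv_cancel_right]]
          exact T₀.mul_mem (T₀.inv_mem hh.1) hk.1))
        exact Fin.ext (Nat.ModEq.eq_of_lt_of_lt h4 i.2 j.2)
      subst h3
      have h5 := mul_right_cancel h2
      subst h5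
      rfl
    · rintro ⟨c, hc⟩
      obtain ⟨i, hi⟩ := htrans c
      obtain ⟨n, rfl⟩ := (hTt i).1 ⟨c, hi, hc⟩
      have h2 : c * ((g ^ α) ^ geomSum (p ^ (s * u)) n)⁻¹ ∈ T₀ :=
        hright _ _ _ (hiter _ _ n ha) (by simpa using hi)
      have h3 : (g ^ α) ^ geomSum (p ^ (s * u)) n *
          ((g ^ α) ^ geomSum (p ^ (s * u)) (n % N))⁻¹ ∈ T₀ := by
        rw [← pow_mul, ← pow_mul, hlog, hαn]
        exact (Nat.mod_modEq n N).symm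
      have h4 := T₀.mul_mem h2 h3
      rw [mul_assoc, inv_mul_cancel_left] at h4
      exact ⟨⟨⟨_, hdiv c _ hc (haiter (n % N)) h4⟩, ⟨n % N, Nat.mod_lt _ hN0⟩⟩,
        Subtype.ext (inv_mul_cancel_right _ _)⟩
  have hNm : N ∣ m :=
    index_dvd_of_norm_condition hp hs hu hm0 hM hpM hsurj hα hnorm hN hcount
  have hK0 : (0 : F) ∈ {c : F | ∀ a ∈ A, c * a ∈ A} := fun a _ => by simp [A.zero_mem]
  have hK1 : (1 : F) ∈ {c : F | ∀ a ∈ A, c * a ∈ A} := fun a ha => by simpa using ha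
  have hHK : Nat.card H ≤ ({c : F | ∀ a ∈ A, c * a ∈ A}).ncard - 1 := by
    rw [← card_units_mem hK0]
    refine Nat.card_le_card_of_injective
      (fun h : H => (⟨h, fun z hz => ?_⟩ : {x : Fˣ // (x : F) ∈ {c : F | ∀ a ∈ A, c * a ∈ A}})) ?_
    · rcases eq_or_ne z 0 with rfl | hz0
      · simp [A.zero_mem]
      · simpa using (hA h 0 (Units.mk0 z hz0) h.2.1 hz).2 h.2.2
    · intro h k heq
      exact Subtype.ext (congrArg (fun q => q.1) heq)
  refine false_of_sq_le_of_sub_one_le hp.two_le ?_ (Nat.le_of_dvd hm0 hNm)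
    (hm ▸ exists_multiplier_bound h1A hx hy hxy)
    (hcount.le.trans (Nat.mul_le_mul_right N hHK))
  exact (Set.one_lt_ncard_iff (Set.toFinite _)).2 ⟨0, 1, hK0, hK1, zero_ne_one⟩

theorem exists_ringEquiv_eq_pow {F : Type*} [Field F] [Fintype F] {p e : ℕ} (hp : p.Prime)
    (hcard : Fintype.card F = p ^ e) (σ : F ≃+* F) : ∃ i : ℕ, ∀ c, σ c = c ^ p ^ i := by
  have := Fact.mk hp
  have hchar : CharP F p := charP_of_card_eq_prime_pow hcard
  let := ZMod.algebra F p
  obtain ⟨i, hi⟩ := (FiniteField.bijective_frobeniusAlgEquivOfAlgebraic_pow (ZMod p) F).surjective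
    (AlgEquiv.ofRingEquiv (f := σ) fun x => by
      exact RingHom.congr_fun (Subsingleton.elim ((σ : F →+* F).comp (algebraMap (ZMod p) F))
        (algebraMap (ZMod p) F)) x)
  refine ⟨i, fun c => ?_⟩
  have h1 := congrFun (FiniteField.coe_frobeniusAlgEquivOfAlgebraic_iterate (ZMod p) F i) c
  have h2 := DFunLike.congr_fun hi c
  rw [ZMod.card] at h1
  rw [← h1, ← AlgEquiv.coe_pow]
  exact h2.symm

section Orbits

variable {V : Type*} [AddCommGroup V] {G : Subgroup (Equiv.Perm V)}

theorem zeroStabOrbit_symm {x y : V} (h : y ∈ zeroStabOrbit G x) : x ∈ zeroStabOrbit G y := by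
  obtain ⟨g, hg, hg0, rfl⟩ := h
  exact ⟨g⁻¹, G.inv_mem hg, by rw [Equiv.Perm.inv_eq_iff_eq, hg0], by simp⟩

theorem zeroStabOrbit_trans {x y z : V} (h : y ∈ zeroStabOrbit G x)
    (h' : z ∈ zeroStabOrbit G y) : z ∈ zeroStabOrbit G x := by
  obtain ⟨g, hg, hg0, rfl⟩ := h
  obtain ⟨k, hk, hk0, rfl⟩ := h'
  exact ⟨k * g, G.mul_mem hk hg, by simp [hg0, hk0], rfl⟩

/-- With two orbits on nonzero vectors, two inequivalent vectors represent both orbits. -/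
theorem HasTwoZeroStabOrbits.mem_or_mem (hrank : HasTwoZeroStabOrbits G) {x y z : V}
    (hx : x ≠ 0) (hy : y ≠ 0) (hz : z ≠ 0) (hxy : y ∉ zeroStabOrbit G x) :
    z ∈ zeroStabOrbit G x ∨ z ∈ zeroStabOrbit G y := by
  obtain ⟨a, b, -, -, -, hab⟩ := hrank
  have key : ∀ {c v w : V}, v ∈ zeroStabOrbit G c → w ∈ zeroStabOrbit G c →
      w ∈ zeroStabOrbit G v := fun hv hw => zeroStabOrbit_trans (zeroStabOrbit_symm hv) hw
  rcases hab x hx with h1 | h1 <;> rcases hab y hy with h2 | h2 <;> rcases hab z hz with h3 | h3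
  · exact absurd (key h1 h2) hxy
  · exact absurd (key h1 h2) hxy
  · exact Or.inl (key h1 h3)
  · exact Or.inr (key h2 h3)
  · exact Or.inr (key h2 h3)
  · exact Or.inl (key h1 h3)
  · exact absurd (key h1 h2) hxy
  · exact absurd (key h1 h2) hxy

/-- If one orbit is closed under nonzero scalars then every vector is equivalent to its nonzero
multiples. -/
theorem smul_mem_zeroStabOrbit {F : Type*} [Field F] [Module F V]
    (hrank : HasTwoZeroStabOrbits G)
    (hsemi : ∀ g ∈ G, g 0 = 0 → ∃ σ : F ≃+* F, ∀ (c : F) (v : V), g (c • v) = σ c • g v)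
    (hx : ∃ x : V, x ≠ 0 ∧
      (Submodule.span F ({x} : Set V) : Set V) \ {0} ⊆ zeroStabOrbit G x)
    {z : V} (hz : z ≠ 0) {c : F} (hc : c ≠ 0) : c • z ∈ zeroStabOrbit G z := by
  obtain ⟨x, hx0, hx⟩ := hx
  have hclosed : ∀ y ∈ zeroStabOrbit G x, ∀ d : F, d ≠ 0 → d • y ∈ zeroStabOrbit G x := by
    rintro y ⟨g, hg, hg0, rfl⟩ d hd
    obtain ⟨σ, hσ⟩ := hsemi g hg hg0
    have h1 : σ.symm d • x ∈ zeroStabOrbit G x := by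
      refine hx ⟨Submodule.smul_mem _ _ (Submodule.mem_span_singleton_self x), ?_⟩
      simpa [hx0] using hd
    refine zeroStabOrbit_trans h1 ⟨g, hg, hg0, ?_⟩
    rw [hσ, RingEquiv.apply_symm_apply]
  by_cases hzx : z ∈ zeroStabOrbit G x
  · exact zeroStabOrbit_trans (zeroStabOrbit_symm hzx) (hclosed z hzx c hc)
  · refine (hrank.mem_or_mem hx0 hz (smul_ne_zero hc hz) hzx).resolve_left fun h => hzx ?_
    simpa [smul_smul, inv_mul_cancel₀ hc] using hclosed _ h c⁻¹ (inv_ne_zero hc)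

end Orbits

namespace PLS

variable {V : Type*} {S : PLS V}

theorem image_mem_lines {g : Equiv.Perm V} (hg : g ∈ S.aut) {L : Set V} (hL : L ∈ S.lines) :
    g '' L ∈ S.lines := by
  have h : g • S.lines = S.lines := hg
  rw [← h]
  exact ⟨L, hL, rfl⟩

/-- If every nonzero vector is on a line through `0`, a translation-invariant partial linear
space is a linear space. -/
theorem isLinearSpace_of_forall_exists [AddCommGroup V]
    (htrans : ∀ v : V, Equiv.addRight v ∈ S.aut)
    (h : ∀ z : V, z ≠ 0 → ∃ L ∈ S.lines, 0 ∈ L ∧ z ∈ L) : S.IsLinearSpace := by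
  intro x y hxy
  obtain ⟨L, hL, h0, hz⟩ := h (y - x) (sub_ne_zero.2 hxy.symm)
  have hL' := image_mem_lines (htrans x) hL
  have hxL : x ∈ Equiv.addRight x '' L := ⟨0, h0, by simp⟩
  have hyL : y ∈ Equiv.addRight x '' L := ⟨y - x, hz, by simp⟩
  exact ⟨_, ⟨hL', hxL, hyL⟩, fun L'' hL'' =>
    S.unique_of_pair _ hL''.1 _ hL' x y hxy hL''.2.1 hL''.2.2 hxL hyL⟩

/-- All nonzero points on lines through `0` are equivalent under the stabiliser of `0`. -/
theorem mem_zeroStabOrbit_of_not_isLinearSpace [AddCommGroup V] {G : Subgroup (Equiv.Perm V)}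
    (htrans : ∀ v : V, Equiv.addRight v ∈ G) (hGS : G ≤ S.aut)
    (hrank : HasTwoZeroStabOrbits G) (hS : ¬ S.IsLinearSpace) {L M : Set V} {u v : V}
    (hL : L ∈ S.lines) (h0L : 0 ∈ L) (huL : u ∈ L) (hu : u ≠ 0)
    (hM : M ∈ S.lines) (h0M : 0 ∈ M) (hvM : v ∈ M) (hv : v ≠ 0) :
    v ∈ zeroStabOrbit G u := by
  by_contra huv
  refine hS (isLinearSpace_of_forall_exists (fun v => hGS (htrans v)) fun z hz => ?_)
  rcases hrank.mem_or_mem hu hv hz huv with ⟨g, hg, hg0, rfl⟩ | ⟨g, hg, hg0, rfl⟩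
  · exact ⟨_, image_mem_lines (hGS hg) hL, ⟨0, h0L, hg0⟩, ⟨u, huL, rfl⟩⟩
  · exact ⟨_, image_mem_lines (hGS hg) hM, ⟨0, h0M, hg0⟩, ⟨v, hvM, rfl⟩⟩

theorem image_eq_of_mem [AddCommGroup V] {g : Equiv.Perm V} (hg : g ∈ S.aut) (hg0 : g 0 = 0)
    {L M : Set V} {u : V} (hL : L ∈ S.lines) (h0L : 0 ∈ L) (huL : u ∈ L) (hu : u ≠ 0)
    (hM : M ∈ S.lines) (h0M : 0 ∈ M) (huM : g u ∈ M) : g '' L = M :=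
  S.unique_of_pair _ (image_mem_lines hg hL) _ hM 0 (g u)
    (fun h => hu (g.injective (by rw [hg0, ← h]))) ⟨0, h0L, hg0⟩ ⟨u, huL, rfl⟩ h0M huM

end PLS

/-- The scalars mapping a nonzero point `u` of a line `W` through `0` into `W` are closed under
multiplication. -/
theorem smul_mem_mul_closed {F V : Type*} [Field F] [Fintype F] [AddCommGroup V] [Module F V]
    {p e : ℕ} (hp : p.Prime) (hcard : Fintype.card F = p ^ e) {G : Subgroup (Equiv.Perm V)}
    (hsemi : ∀ g ∈ G, g 0 = 0 → ∃ σ : F ≃+* F, ∀ (c : F) (v : V), g (c • v) = σ c • g v)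
    {S : PLS V} (hGS : G ≤ S.aut) {W : AddSubgroup V} (hW : (W : Set V) ∈ S.lines) {u : V}
    (hu : u ≠ 0) (huW : u ∈ W) (horb : ∀ c : F, c ≠ 0 → c • u ∈ zeroStabOrbit G u)
    {x y : F} (hx : x • u ∈ W) (hy : y • u ∈ W) : (x * y) • u ∈ W := by
  have hinj : Function.Injective fun c : F => c • u := smul_left_injective F hu
  let T : Fˣ → ℕ → Prop := fun c i =>
    ∃ g ∈ G, g 0 = 0 ∧ ∀ d : F, g (d • u) = ((c : F) * d ^ p ^ i) • u
  have hfrob : ∀ d : F, d ^ p ^ e = d := fun d => by rw [← hcard, FiniteField.pow_card]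
  have hinv0 : ∀ g : Equiv.Perm V, g 0 = 0 → g⁻¹ 0 = 0 := fun g hg => by
    rw [Equiv.Perm.inv_eq_iff_eq, hg]
  have hgW : ∀ g ∈ G, g 0 = 0 → ∀ v ∈ W, v ≠ 0 → g v ∈ W → ∀ w, g w ∈ W ↔ w ∈ W := by
    intro g hg hg0 v hv hv0 hgv w
    have h := PLS.image_eq_of_mem (hGS hg) hg0 hW W.zero_mem hv hv0 hW W.zero_mem hgv
    rw [← SetLike.mem_coe, ← h]
    exact g.injective.mem_set_image
  let A : AddSubgroup F := W.comap ((LinearMap.toSpanSingleton F V u).toAddMonoidHom)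
  have hA : ∀ c, c ∈ A ↔ c • u ∈ W := fun c => Iff.rfl
  have hone : ∀ (c : Fˣ) (i : ℕ) (g : Equiv.Perm V),
      (∀ d : F, g (d • u) = ((c : F) * d ^ p ^ i) • u) → g u = (c : F) • u :=
    fun c i g hg => by simpa using hg 1
  refine (hA _).1 (mul_mem_of_transitive_semilinear hp (by rw [Nat.card_eq_fintype_card, hcard])
    T ?_ ?_ ?_ ?_ ?_ A ((hA _).2 (by simpa using huW)) ?_ ?_ hx hy)
  · rintro c d i j ⟨g, hg, hg0, hgc⟩ ⟨k, hk, hk0, hkd⟩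
    refine ⟨g * k, G.mul_mem hg hk, by simp [hg0, hk0], fun x => ?_⟩
    rw [Equiv.Perm.mul_apply, hkd, hgc]
    push_cast
    rw [mul_pow, ← pow_mul, ← pow_add, add_comm j i, mul_assoc]
  · rintro c d i j ⟨g, hg, hg0, hgc⟩ ⟨k, hk, hk0, hkd⟩
    refine ⟨g⁻¹ * k, G.mul_mem (G.inv_mem hg) hk,
      by rw [Equiv.Perm.mul_apply, hk0, hinv0 g hg0], fun x => ?_⟩
    rw [Equiv.Perm.mul_apply, Equiv.Perm.inv_eq_iff_eq, hkd, hgc]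
    push_cast
    rw [mul_pow, ← pow_mul, ← pow_add, add_comm j i, mul_assoc]
  · rintro c d i ⟨g, hg, hg0, hgc⟩ ⟨k, hk, hk0, hkd⟩
    refine ⟨k * g⁻¹, G.mul_mem hk (G.inv_mem hg),
      by rw [Equiv.Perm.mul_apply, hinv0 g hg0, hk0], fun x => ?_⟩
    have hginj : Function.Injective fun z : F => (c : F) * z ^ p ^ i := fun a b hab =>
      hinj (g.injective (by
        have : (c : F) * a ^ p ^ i = c * b ^ p ^ i := hab
        simp only [hgc, this]))
    obtain ⟨z, hz⟩ := (Finite.injective_iff_surjective.1 hginj) x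
    have hz' : (c : F) * z ^ p ^ i = x := hz
    have h1 : g⁻¹ (x • u) = z • u := by rw [Equiv.Perm.inv_eq_iff_eq, hgc, hz']
    rw [Equiv.Perm.mul_apply, h1, hkd, ← hz']
    push_cast
    rw [pow_zero, pow_one, mul_assoc]
  · exact ⟨1, G.one_mem, rfl, fun d => by simp [hfrob]⟩
  · intro c
    obtain ⟨g, hg, hg0, hgu⟩ := horb c c.ne_zero
    obtain ⟨σ, hσ⟩ := hsemi g hg hg0
    obtain ⟨i, hi⟩ := exists_ringEquiv_eq_pow hp hcard σ
    exact ⟨i, g, hg, hg0, fun d => by rw [hσ, hgu, hi, smul_smul, mul_comm]⟩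
  · rintro c i x ⟨g, hg, hg0, hgc⟩ hxA
    rw [hA, hA, ← hone c i g hgc]
    push_cast
    rw [← hgc]
    have hxW : (x : F) • u ∈ W := hxA
    constructor
    · intro h
      exact (hgW g hg hg0 _ hxW (smul_ne_zero x.ne_zero hu) h u).2 huW
    · intro h
      exact (hgW g hg hg0 u huW hu h _).2 hxW
  · rintro c i x ⟨g, hg, hg0, hgc⟩ hcA hcx
    rw [hA] at hcA hcx ⊢
    push_cast at hcx
    rw [← hgc] at hcx
    rw [← hone c i g hgc] at hcA
    exact (hgW g hg hg0 u huW hu hcA _).1 hcx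

/-- **Lemma 4.3.** Let `G` be an affine rank 3 permutation group on `V = V_n(q)`,
`q = p^e`, with `G₀ ≤ ΓL_n(q)` and the punctured span condition, and let `S` be a
`G`-affine proper partial linear space all of whose lines are affine `F_p`-subspaces of
`V`.  Then there is a subfield `K` of `F_q` such that every line through `0` is a
`K`-subspace `L` of `V` with `K = {λ | λ • u ∈ L}` for every `u ∈ L \ {0}`. -/
theorem closed_scalar_subfield
    {n p e : ℕ} (hn : 1 ≤ n) (hp : p.Prime)
    (F : Type*) [Field F] [Fintype F] (hcard : Fintype.card F = p ^ e)
    (V : Type*) [AddCommGroup V] [Module F V] [Finite V]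
    (hdim : Module.finrank F V = n)
    (G : Subgroup (Equiv.Perm V))
    (haff : IsAffinePermGroup G) (hrank : HasTwoZeroStabOrbits G)
    (hsemi : ∀ g ∈ G, g 0 = 0 →
      ∃ σ : F ≃+* F, ∀ (c : F) (v : V), g (c • v) = σ c • g v)
    (hx : ∃ x : V, x ≠ 0 ∧
      (Submodule.span F ({x} : Set V) : Set V) \ {0} ⊆ zeroStabOrbit G x)
    (S : PLS V) (hproper : S.IsProper) (hGS : G ≤ S.aut)
    (haffsub : ∀ L ∈ S.lines, ∃ (W : AddSubgroup V) (v : V),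
      L = (fun w : V => w + v) '' (W : Set V)) :
    ∃ K : Subfield F, ∀ L ∈ S.lines, (0 : V) ∈ L →
      ((∀ x ∈ L, ∀ y ∈ L, x + y ∈ L) ∧
       (∀ c ∈ K, ∀ x ∈ L, c • x ∈ L) ∧
       ∀ u ∈ L, u ≠ 0 → {c : F | c • u ∈ L} = (K : Set F)) := by
  obtain ⟨hadd, -⟩ := haff
  have hsub : ∀ L ∈ S.lines, (0 : V) ∈ L → ∃ W : AddSubgroup V, L = W := by
    intro L hL h0
    obtain ⟨W, v, rfl⟩ := haffsub L hL
    obtain ⟨w, hw, hwv⟩ := h0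
    have hv : v ∈ W := by
      rw [← neg_eq_of_add_eq_zero_right hwv]
      exact W.neg_mem hw
    refine ⟨W, Set.ext fun z => ⟨?_, fun hz => ⟨z - v, W.sub_mem hz hv, sub_add_cancel z v⟩⟩⟩
    rintro ⟨a, ha, rfl⟩
    exact W.add_mem ha hv
  by_cases hex : ∃ L ∈ S.lines, (0 : V) ∈ L
  swap
  · exact ⟨⊤, fun L hL h0 => absurd ⟨L, hL, h0⟩ hex⟩
  obtain ⟨L₀, hL₀, h0L₀⟩ := hex
  obtain ⟨W₀, rfl⟩ := hsub L₀ hL₀ h0L₀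
  obtain ⟨u₀, hu₀W, hu₀⟩ := Set.exists_ne_of_one_lt_ncard (S.two_le_ncard _ hL₀) 0
  have hmul : ∀ x y : F, x • u₀ ∈ W₀ → y • u₀ ∈ W₀ → (x * y) • u₀ ∈ W₀ := fun x y =>
    smul_mem_mul_closed hp hcard hsemi hGS hL₀ hu₀ hu₀W
      (fun c hc => smul_mem_zeroStabOrbit hrank hsemi hx hu₀ hc)
  have hpow : ∀ (x : F) (k : ℕ), x • u₀ ∈ W₀ → x ^ k • u₀ ∈ W₀ := by
    intro x k hxW
    induction k with
    | zero => simpa using hu₀W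
    | succ k ih => rw [pow_succ]; exact hmul _ _ ih hxW
  let K : Subfield F :=
    { carrier := {c | c • u₀ ∈ W₀}
      mul_mem' := fun {x y} hxW hyW => hmul x y hxW hyW
      one_mem' := by simpa using hu₀W
      add_mem' := fun {x y} hxW hyW => by
        change (x + y) • u₀ ∈ W₀
        rw [add_smul]; exact W₀.add_mem hxW hyW
      zero_mem' := by simp
      neg_mem' := fun {x} hxW => by
        change (-x) • u₀ ∈ W₀
        rw [neg_smul]; exact W₀.neg_mem hxW
      inv_mem' := fun x hxW => by
        change x⁻¹ • u₀ ∈ W₀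
        rcases eq_or_ne x 0 with rfl | hx0
        · simp
        · obtain ⟨k, hk⟩ : ∃ k, Fintype.card F - 1 = k + 1 :=
            Nat.exists_eq_add_of_le' (Nat.sub_pos_of_lt Fintype.one_lt_card)
          have h1 := FiniteField.pow_card_sub_one_eq_one x hx0
          rw [hk, pow_succ] at h1
          rw [← eq_inv_of_mul_eq_one_left h1]
          exact hpow x k hxW }
  have hK : ∀ c, c ∈ K ↔ c • u₀ ∈ W₀ := fun c => Iff.rfl
  have hscalar : ∀ L ∈ S.lines, (0 : V) ∈ L → ∀ u ∈ L, u ≠ 0 → ∀ c : F, c • u ∈ L ↔ c ∈ K := by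
    intro L hL h0 u huL hu c
    obtain ⟨g, hg, hg0, rfl⟩ := PLS.mem_zeroStabOrbit_of_not_isLinearSpace hadd hGS hrank
      hproper.1 hL₀ h0L₀ hu₀W hu₀ hL h0 huL hu
    obtain ⟨σ, hσ⟩ := hsemi g hg hg0
    have himg := PLS.image_eq_of_mem (hGS hg) hg0 hL₀ h0L₀ hu₀W hu₀ hL h0 huL
    have h1 : c • g u₀ = g (σ.symm c • u₀) := by rw [hσ, RingEquiv.apply_symm_apply]
    rw [h1, ← himg, g.injective.mem_set_image, SetLike.mem_coe, ← hK]
    obtain ⟨i, hi⟩ := exists_ringEquiv_eq_pow hp hcard σ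
    obtain ⟨j, hj⟩ := exists_ringEquiv_eq_pow hp hcard σ.symm
    constructor
    · intro h
      rw [← σ.apply_symm_apply c, hi]
      exact K.pow_mem h _
    · intro h
      rw [hj]
      exact K.pow_mem h _
  refine ⟨K, fun L hL h0 => ⟨?_, ?_, fun u huL hu => Set.ext (hscalar L hL h0 u huL hu)⟩⟩
  · obtain ⟨W, rfl⟩ := hsub L hL h0
    exact fun x hxW y hyW => W.add_mem hxW hyW
  · intro c hc x hxL
    rcases eq_or_ne x 0 with rfl | hx0
    · rwa [smul_zero]
    · exact (hscalar L hL h0 x hxL hx0 c).2 hc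
end

section
/- Let q := p^e where p is a prime and e ≥ 1, and let s := p^f where 1 ≤ f < 2e and f divides 2e. If (q + 1)/gcd(q + 1, 4e) divides s − 1, then (q, s) is one of (3, 3), (7, 7), or (8, 4). -/
theorem Nat.pow_sub_one_dvd_pow_mul_sub_one (p a b : ℕ) : p ^ a - 1 ∣ p ^ (a * b) - 1 := by
  simpa [pow_mul] using Nat.sub_dvd_pow_sub_pow (p ^ a) 1 b

theorem Nat.le_mul_of_div_gcd_dvd {n m x : ℕ} (hm : 0 < m) (hx : 0 < x)
    (h : n / Nat.gcd n m ∣ x) : n ≤ m * x := by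
  calc n = Nat.gcd n m * (n / Nat.gcd n m) := (Nat.mul_div_cancel' (Nat.gcd_dvd_left n m)).symm
    _ ≤ m * x := Nat.mul_le_mul (Nat.gcd_le_right n hm) (Nat.le_of_dvd hx h)

/-- If `f ∣ e`, the hypothesis on `p ^ e + 1` leaves only small `p` and `e`. -/
theorem small_of_exponent_dvd {p e f : ℕ} (hp : 2 ≤ p) (he : 1 ≤ e) (hfe : f ∣ e)
    (h : (p ^ e + 1) / Nat.gcd (p ^ e + 1) (4 * e) ∣ p ^ f - 1) : p < 8 ∧ e < 6 := by
  obtain ⟨c, hc⟩ := hfe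
  have hq : 1 ≤ p ^ e := Nat.one_le_pow _ _ (by omega)
  have hsub : p ^ f - 1 ∣ p ^ e - 1 := hc ▸ Nat.pow_sub_one_dvd_pow_mul_sub_one p f c
  have htwo : (p ^ e + 1) / Nat.gcd (p ^ e + 1) (4 * e) ∣ 2 := by
    have := Nat.dvd_sub (Nat.div_dvd_of_dvd (Nat.gcd_dvd_left (p ^ e + 1) (4 * e)))
      (h.trans hsub)
    rwa [show p ^ e + 1 - (p ^ e - 1) = 2 by omega] at this
  have hle := Nat.le_mul_of_div_gcd_dvd (by omega) two_pos htwo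
  constructor
  · by_contra! hp8
    have h1 : 8 ^ e ≤ p ^ e := Nat.pow_le_pow_left hp8 e
    have h2 : ∀ n, 1 ≤ n → 8 * n ≤ 8 ^ n := fun n hn => by
      induction n, hn using Nat.le_induction with
      | base => norm_num
      | succ n hn ih => rw [pow_succ]; omega
    have := h2 e he
    omega
  · by_contra! he6
    have h1 : 2 ^ e ≤ p ^ e := Nat.pow_le_pow_left hp e
    have h2 : ∀ n, 6 ≤ n → 8 * n ≤ 2 ^ n := fun n hn => by
      induction n, hn using Nat.le_induction with
      | base => norm_num
      | succ n hn ih => rw [pow_succ]; omega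
    have := h2 e he6
    omega

/-- If `f ∣ 2 * e` is a proper divisor with `f ∤ e`, the hypothesis on `p ^ e + 1` leaves only
small `p` and `e`. -/
theorem small_of_not_exponent_dvd {p e f : ℕ} (hp : 2 ≤ p) (he : 1 ≤ e)
    (hflt : f < 2 * e) (hfdvd : f ∣ 2 * e) (hfe : ¬ f ∣ e)
    (h : (p ^ e + 1) / Nat.gcd (p ^ e + 1) (4 * e) ∣ p ^ f - 1) : p < 8 ∧ e < 10 := by
  obtain ⟨c, hc⟩ := hfdvd
  obtain ⟨j, rfl⟩ : Odd c := by
    rw [← Nat.not_even_iff_odd]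
    rintro ⟨k, rfl⟩
    exact hfe ⟨k, by linarith⟩
  obtain ⟨d, rfl⟩ : ∃ d, f = 2 * d := ⟨e - f * j, by
    have : f * (2 * j + 1) = 2 * (f * j) + f := by ring
    omega⟩
  have hed : e = d + 2 * d * j := by linarith
  have hj : 1 ≤ j := by
    by_contra! hj
    obtain rfl : j = 0 := by omega
    omega
  have hd : d ≤ d * j := Nat.le_mul_of_pos_right d hj
  have hdk : 2 * d * j = 2 * (d * j) := by ring
  obtain ⟨k, hk⟩ : ∃ k, k = 2 * d * j := ⟨_, rfl⟩
  rw [← hk] at hed hdk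
  have hpd : 1 ≤ p ^ d := Nat.one_le_pow _ _ (by omega)
  have hpk : 1 ≤ p ^ k := Nat.one_le_pow _ _ (by omega)
  have hmul : p ^ e = p ^ d * p ^ k := by rw [hed, pow_add]
  have hsub : p ^ (2 * d) - 1 ∣ p ^ d * (p ^ k - 1) :=
    (hk ▸ Nat.pow_sub_one_dvd_pow_mul_sub_one p (2 * d) j).mul_left _
  have hdvd : (p ^ e + 1) / Nat.gcd (p ^ e + 1) (4 * e) ∣ p ^ d + 1 := by
    have := Nat.dvd_sub (Nat.div_dvd_of_dvd (Nat.gcd_dvd_left (p ^ e + 1) (4 * e)))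
      (h.trans hsub)
    have hle : p ^ d ≤ p ^ d * p ^ k := Nat.le_mul_of_pos_right _ hpk
    rwa [Nat.mul_sub, mul_one, ← hmul,
      show p ^ e + 1 - (p ^ e - p ^ d) = p ^ d + 1 by omega] at this
  have hle := Nat.le_mul_of_div_gcd_dvd (by omega) (by omega) hdvd
  have hbound : p ^ k ≤ 12 * k := by
    have h1 : p ^ d * p ^ k ≤ p ^ d * (8 * e) := by nlinarith
    have h2 := Nat.le_of_mul_le_mul_left h1 hpd
    omega
  have hk2 : 2 ≤ k := by omega
  constructor
  · by_contra! hp8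
    have h1 : 8 ^ k ≤ p ^ k := Nat.pow_le_pow_left hp8 k
    have h2 : ∀ n, 2 ≤ n → 12 * n < 8 ^ n := fun n hn => by
      induction n, hn using Nat.le_induction with
      | base => norm_num
      | succ n hn ih => rw [pow_succ]; omega
    have := h2 k hk2
    omega
  · by_contra! he10
    have h1 : 2 ^ k ≤ p ^ k := Nat.pow_le_pow_left hp k
    have h2 : ∀ n, 7 ≤ n → 12 * n < 2 ^ n := fun n hn => by
      induction n, hn using Nat.le_induction with
      | base => norm_num
      | succ n hn ih => rw [pow_succ]; omega
    have := h2 k (by omega)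
    omega

set_option maxRecDepth 100000 in
theorem exceptional_prime_power_pairs_of_lt : ∀ p ∈ [2, 3, 5, 7], ∀ e < 10, ∀ f < 2 * e,
    (1 ≤ f ∧ f ∣ 2 * e ∧ (p ^ e + 1) / Nat.gcd (p ^ e + 1) (4 * e) ∣ p ^ f - 1) →
    (p ^ e = 3 ∧ p ^ f = 3) ∨ (p ^ e = 7 ∧ p ^ f = 7) ∨ (p ^ e = 8 ∧ p ^ f = 4) := by
  decide

/-- **Lemma 9.3.** Let `q = p^e` and `s = p^f` with `p` prime, `1 ≤ f < 2e` and
`f ∣ 2e`.  If `(q+1)/gcd(q+1, 4e)` divides `s - 1`, then `(q, s)` is `(3,3)`, `(7,7)` or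
`(8,4)`. -/
theorem exceptional_prime_power_pairs
    (p e f : ℕ) (hp : p.Prime) (he : 1 ≤ e)
    (hf : 1 ≤ f) (hflt : f < 2 * e) (hfdvd : f ∣ 2 * e)
    (h : (p ^ e + 1) / Nat.gcd (p ^ e + 1) (4 * e) ∣ p ^ f - 1) :
    (p ^ e = 3 ∧ p ^ f = 3) ∨ (p ^ e = 7 ∧ p ^ f = 7) ∨ (p ^ e = 8 ∧ p ^ f = 4) := by
  have hsmall : p < 8 ∧ e < 10 := by
    by_cases hfe : f ∣ e
    · have := small_of_exponent_dvd hp.two_le he hfe h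
      omega
    · exact small_of_not_exponent_dvd hp.two_le he hflt hfdvd hfe h
  have hmem : p ∈ [2, 3, 5, 7] := by
    have hp8 := hsmall.1
    interval_cases p <;> first | decide | (exfalso; revert hp; norm_num)
  exact exceptional_prime_power_pairs_of_lt p hmem e hsmall.2 f hflt ⟨hf, hfdvd, h⟩
end

section
/- Let p be an odd prime, let d ≥ 1, and let q := p^d. Let G_0 be a subgroup of ΓL_1(q), the group of all permutations of F_q of the form x ↦ a · x^σ with a ∈ F_q^× and σ a field automorphism of F_q. Suppose that G_0 has t orbits on F_q \ {0}, where t ≤ 2, and suppose that |G_0| is even when t = 2. Then the negation map x ↦ −x belongs to G_0. -/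
open SemidirectProduct

/-- The action of the field automorphisms of `F` on its unit group. -/
def unitsAutHom (F : Type*) [Field F] : RingAut F →* MulAut Fˣ where
  toFun σ := Units.mapEquiv σ.toMulEquiv
  map_one' := by ext; rfl
  map_mul' _ _ := by ext; rfl

/-- The action of the field automorphisms of `F` on its `n`-th roots of unity. -/
def rootsOfUnityAutHom (F : Type*) [Field F] (n : ℕ) :
    RingAut F →* MulAut (rootsOfUnity n F) where
  toFun σ := σ.toMulEquiv.restrictRootsOfUnity n
  map_one' := by ext; rfl
  map_mul' _ _ := by ext; rfl

/-- The semilinear group `ΓL₁(F)` as a semidirect product. -/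
abbrev SemilinearGroup (F : Type*) [Field F] := Fˣ ⋊[unitsAutHom F] RingAut F

instance (F : Type*) [Field F] [Finite F] : Finite (RingAut F) :=
  Finite.of_injective (fun σ : RingAut F => (σ : F → F)) DFunLike.coe_injective

instance (F : Type*) [Field F] [Finite F] : Finite (SemilinearGroup F) :=
  Finite.of_equiv _ SemidirectProduct.equivProd.symm

/-- The permutation `x ↦ a * σ x` attached to `(a, σ)`. -/
def SemilinearGroup.toPerm (F : Type*) [Field F] : SemilinearGroup F →* Equiv.Perm F :=
  SemidirectProduct.lift (MulAction.toPermHom Fˣ F) (MulAction.toPermHom (RingAut F) F) <| by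
    intro σ
    ext u x
    change σ u * x = σ (u * σ⁻¹ x)
    rw [map_mul]
    congr 1
    exact (σ.apply_symm_apply x).symm

theorem SemilinearGroup.toPerm_apply {F : Type*} [Field F] (g : SemilinearGroup F) (x : F) :
    toPerm F g x = g.left * g.right x := rfl

/-- The power map `u ↦ u ^ m` from units to `n`-th roots of unity, where `n * m = |Fˣ|`. -/
def powToRootsOfUnity (F : Type*) [Field F] {n m : ℕ} (h : n * m = Nat.card Fˣ) :
    Fˣ →* rootsOfUnity n F :=
  (powMonoidHom m).codRestrict _ fun u => by
    rw [mem_rootsOfUnity, powMonoidHom_apply, ← pow_mul, mul_comm, h, pow_card_eq_one']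

/-- The homomorphism from the semilinear group to the holomorph of the `n`-th roots of unity
induced by the power map. -/
def SemilinearGroup.toHolomorph (F : Type*) [Field F] {n m : ℕ} (h : n * m = Nat.card Fˣ) :
    SemilinearGroup F →* rootsOfUnity n F ⋊[MonoidHom.id _] MulAut (rootsOfUnity n F) :=
  SemidirectProduct.map (powToRootsOfUnity F h) (rootsOfUnityAutHom F n) <| by
    intro σ
    ext u
    exact (map_pow σ (u : F) m).symm

theorem card_ringAut_eq {p d : ℕ} (hp : p.Prime) {F : Type*} [Field F] [Fintype F]
    (hcard : Fintype.card F = p ^ d) : Nat.card (RingAut F) = d := by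
  have : Fact p.Prime := ⟨hp⟩
  have : CharP F p := charP_of_card_eq_prime_pow hcard
  let : Algebra (ZMod p) F := ZMod.algebra F p
  have h1 : Nat.card (F ≃ₐ[ZMod p] F) = Module.finrank (ZMod p) F :=
    IsGalois.card_aut_eq_finrank _ _
  have h2 : Fintype.card F = p ^ Module.finrank (ZMod p) F := by
    rw [Module.card_eq_pow_finrank (K := ZMod p), ZMod.card]
  have h3 : Module.finrank (ZMod p) F = d :=
    Nat.pow_right_injective hp.two_le (h2.symm.trans hcard)
  rw [← h3, ← h1]
  refine Nat.card_congr ⟨fun σ => AlgEquiv.ofRingEquiv (f := σ) fun x => ?_,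
    fun σ => σ.toRingEquiv, fun _ => rfl, fun _ => rfl⟩
  exact DFunLike.congr_fun
    (Subsingleton.elim ((σ : F →+* F).comp (algebraMap (ZMod p) F)) (algebraMap (ZMod p) F)) x

theorem dvd_card_ringAut_of_neg_notMem {F : Type*} [Field F] [Fintype F]
    {G : Subgroup (SemilinearGroup F)} (hneg : inl (-1) ∉ G) {j : ℕ} (hj : 2 ^ j ∣ Nat.card G) :
    2 ^ j ∣ Nat.card (RingAut F) := by
  let f : G →* RingAut F := rightHom.comp G.subtype
  have hodd : ¬ 2 ∣ Nat.card f.ker := by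
    intro h
    obtain ⟨g, hg⟩ := exists_prime_orderOf_dvd_card' (G := f.ker) 2 h
    obtain ⟨⟨⟨u, σ⟩, hG⟩, hk⟩ := g
    obtain rfl : σ = 1 := hk
    have hg' : orderOf (inl u : SemilinearGroup F) = 2 := by
      rw [← hg, ← Subgroup.orderOf_coe, ← Subgroup.orderOf_coe]
      rfl
    rw [orderOf_injective _ inl_injective] at hg'
    have hu1 : u ≠ 1 := by
      rintro rfl
      simp at hg'
    have hu2 : u ^ 2 = 1 := hg' ▸ pow_orderOf_eq_one u
    have hu : u = -1 := by
      rcases mul_self_eq_one_iff.mp (show (u : F) * u = 1 by rw [← sq]; exact congrArg Units.val hu2) with h | h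
      · exact absurd (Units.ext h) hu1
      · exact Units.ext h
    exact hneg (hu ▸ hG)
  have hcop : Nat.Coprime (2 ^ j) (Nat.card f.ker) :=
    Nat.Coprime.pow_left _ ((Nat.prime_two.coprime_iff_not_dvd).mpr hodd)
  have hmul : Nat.card f.ker * Nat.card f.range = Nat.card G := by
    rw [← Subgroup.index_ker, Subgroup.card_mul_index]
  rw [← hmul] at hj
  exact (hcop.dvd_of_dvd_mul_left hj).trans (Subgroup.card_subgroup_dvd_card _)

theorem pow_add_two_dvd_pow_sub_one {p d j : ℕ} (hp : 1 < p) (hodd : Odd p) (hd : d ≠ 0)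
    (hev : Even d) (hj : 2 ^ j ∣ d) : 2 ^ (j + 2) ∣ p ^ d - 1 := by
  have hd1 : p ^ d - 1 ≠ 0 := by
    have := Nat.one_lt_pow hd hp
    omega
  rw [padicValNat_dvd_iff_le hd1]
  rw [padicValNat_dvd_iff_le hd] at hj
  have := padicValNat.pow_two_sub_one_ge hp (by
    rw [← even_iff_two_dvd]; exact Nat.not_even_iff_odd.mpr hodd) hd hev
  omega

theorem card_rootsOfUnity_two_pow {F : Type*} [Field F] [Fintype F] {k : ℕ}
    (h : 2 ^ k ∣ Nat.card Fˣ) : Nat.card (rootsOfUnity (2 ^ k) F) = 2 ^ k := by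
  refine le_antisymm ?_ ?_
  · exact card_rootsOfUnity F (2 ^ k)
  · obtain ⟨K, hK⟩ := Sylow.exists_subgroup_card_pow_prime 2 h
    refine hK.symm.le.trans (Subgroup.card_le_of_le fun u hu => ?_)
    rw [mem_rootsOfUnity]
    have := congrArg Subtype.val (pow_card_eq_one' (x := (⟨u, hu⟩ : K)))
    rwa [hK] at this

theorem powToRootsOfUnity_surjective {F : Type*} [Field F] [Fintype F] {k m : ℕ}
    (h : 2 ^ k * m = Nat.card Fˣ) (hm : Odd m) :
    Function.Surjective (powToRootsOfUnity F h) := by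
  intro ζ
  have hcop : (Nat.card (rootsOfUnity (2 ^ k) F)).Coprime m := by
    rw [card_rootsOfUnity_two_pow ⟨m, h.symm⟩]
    exact Nat.Coprime.pow_left _ hm.coprime_two_left
  obtain ⟨u, hu⟩ := (powCoprime hcop).surjective ζ
  exact ⟨u, Subtype.ext (congrArg Subtype.val hu)⟩

theorem exists_card_map_toHolomorph {F : Type*} [Field F] [Fintype F] {k m : ℕ}
    (h : 2 ^ k * m = Nat.card Fˣ) (G : Subgroup (SemilinearGroup F)) :
    ∃ j, Nat.card (G.map (SemilinearGroup.toHolomorph F h)) = 2 ^ j := by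
  have hdvd := Subgroup.card_subgroup_dvd_card (G.map (SemilinearGroup.toHolomorph F h))
  have hμ := card_rootsOfUnity_two_pow ⟨m, h.symm⟩
  rw [SemidirectProduct.card, IsCyclic.card_mulAut, hμ] at hdvd
  suffices ∃ l, (2 ^ k).totient = 2 ^ l by
    obtain ⟨l, hl⟩ := this
    rw [hl, ← pow_add] at hdvd
    obtain ⟨j, -, hj⟩ := (Nat.dvd_prime_pow Nat.prime_two).mp hdvd
    exact ⟨j, hj⟩
  rcases k.eq_zero_or_pos with rfl | hk
  · exact ⟨0, by simp⟩
  · exact ⟨k - 1, by simp [Nat.totient_prime_pow Nat.prime_two hk]⟩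

/-- If the orbits of the points `x i` cover `Fˣ`, then the induced orbits cover the roots of
unity of order `2 ^ k`. -/
theorem two_pow_le_card_mul_card_map {F : Type*} [Field F] [Fintype F] {k m : ℕ}
    (h : 2 ^ k * m = Nat.card Fˣ) (hm : Odd m) {G : Subgroup (SemilinearGroup F)}
    {ι : Type*} [Finite ι] (x : ι → Fˣ)
    (hx : ∀ z : Fˣ, ∃ i, ∃ g ∈ G, SemilinearGroup.toPerm F g (x i) = z) :
    2 ^ k ≤ Nat.card ι * Nat.card (G.map (SemilinearGroup.toHolomorph F h)) := by
  refine (card_rootsOfUnity_two_pow (F := F) ⟨m, h.symm⟩).symm.le.trans ?_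
  have : Finite (G.map (SemilinearGroup.toHolomorph F h)) :=
    Finite.of_surjective _ ((SemilinearGroup.toHolomorph F h).subgroupMap_surjective G)
  rw [← Nat.card_prod]
  refine Nat.card_le_card_of_surjective
    (fun a => a.2.1.left * a.2.1.right (powToRootsOfUnity F h (x a.1))) fun ζ => ?_
  obtain ⟨z, rfl⟩ := powToRootsOfUnity_surjective h hm ζ
  obtain ⟨i, g, hg, hgz⟩ := hx z
  refine ⟨⟨i, _, Subgroup.mem_map_of_mem _ hg⟩, ?_⟩
  ext
  rw [SemilinearGroup.toPerm_apply] at hgz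
  change (g.left : F) ^ m * g.right ((x i : F) ^ m) = (z : F) ^ m
  rw [← hgz, mul_pow, map_pow]

theorem inl_neg_one_mem_of_orbits {p d : ℕ} (hp : p.Prime) (hodd : Odd p) (hd : d ≠ 0)
    {F : Type*} [Field F] [Fintype F] (hcard : Fintype.card F = p ^ d)
    {G : Subgroup (SemilinearGroup F)} {ι : Type*} [Finite ι] (x : ι → Fˣ)
    (hx : ∀ z : Fˣ, ∃ i, ∃ g ∈ G, SemilinearGroup.toPerm F g (x i) = z)
    (hι : Nat.card ι ≤ 1 ∨ Nat.card ι = 2 ∧ Even (Nat.card G)) :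
    inl (-1) ∈ G := by
  by_contra hneg
  have hU : Nat.card Fˣ = p ^ d - 1 := by
    rw [Nat.card_units, Nat.card_eq_fintype_card, hcard]
  obtain ⟨k, m, hm, hkm⟩ := Nat.exists_eq_two_pow_mul_odd (n := Nat.card Fˣ) Nat.card_pos.ne'
  have hle := two_pow_le_card_mul_card_map hkm.symm hm x hx
  obtain ⟨j, hj⟩ := exists_card_map_toHolomorph hkm.symm G
  have hjd := dvd_card_ringAut_of_neg_notMem hneg (hj ▸ Subgroup.card_map_dvd G _)
  rw [card_ringAut_eq hp hcard] at hjd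
  rw [hj] at hle
  have hk {l : ℕ} (hl : 2 ^ l ∣ p ^ d - 1) : 2 ^ l ≤ 2 ^ k := by
    rw [← hU, hkm] at hl
    exact Nat.le_of_dvd (by positivity)
      ((Nat.Coprime.pow_left l hm.coprime_two_left).dvd_of_dvd_mul_right hl)
  rcases Nat.even_or_odd d with hev | hdo
  · have h1 := hk (pow_add_two_dvd_pow_sub_one hp.one_lt hodd hd hev hjd)
    have h2 : Nat.card ι * 2 ^ j ≤ 2 * 2 ^ j := by gcongr; omega
    have : 0 < 2 ^ j := by positivity
    rw [pow_add] at h1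
    omega
  · have hj0 : 2 ^ j = 1 := Nat.Coprime.eq_one_of_dvd
      (Nat.Coprime.pow_left j hdo.coprime_two_left) hjd
    have h1 : 2 ^ 1 ≤ 2 ^ k := hk (by
      rw [pow_one, ← even_iff_two_dvd]
      exact Nat.Odd.sub_odd hodd.pow odd_one)
    rcases hι with hι | ⟨-, hG⟩
    · rw [hj0] at hle
      omega
    · have := dvd_card_ringAut_of_neg_notMem hneg (j := 1) (by simpa using hG.two_dvd)
      rw [card_ringAut_eq hp hcard, pow_one, ← even_iff_two_dvd] at this
      exact (Nat.not_even_iff_odd.mpr hdo) this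


/-- **Lemma 12.1.** Let `p` be an odd prime, `q = p^d`, and let `G₀ ≤ ΓL₁(q)` (every
element of `G₀` has the form `x ↦ a·σ(x)` for a unit `a` and a field automorphism `σ`).
If `G₀` has at most two orbits on `F_q \ {0}`, and `|G₀|` is even in case of exactly two
orbits, then the negation map lies in `G₀`. -/
theorem neg_mem_of_semilinear
    (p d : ℕ) (hp : p.Prime) (hodd : Odd p) (hd : 1 ≤ d)
    (F : Type*) [Field F] [Fintype F] (hcard : Fintype.card F = p ^ d)
    (G₀ : Subgroup (Equiv.Perm F))
    (hsemi : ∀ g ∈ G₀, ∃ (a : F) (σ : F ≃+* F), a ≠ 0 ∧ ∀ x : F, g x = a * σ x)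
    (horb :
      (∀ x y : F, x ≠ 0 → y ≠ 0 → ∃ g ∈ G₀, g x = y) ∨
      (Even (Nat.card G₀) ∧ ∃ x y : F, x ≠ 0 ∧ y ≠ 0 ∧
        {z : F | ∃ g ∈ G₀, g x = z} ≠ {z : F | ∃ g ∈ G₀, g y = z} ∧
        ∀ z : F, z ≠ 0 → ((∃ g ∈ G₀, g x = z) ∨ (∃ g ∈ G₀, g y = z)))) :
    Equiv.neg F ∈ G₀ := by
  let Φ := SemilinearGroup.toPerm F
  have hrange : ∀ g ∈ G₀, ∃ γ, Φ γ = g := by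
    intro g hg
    obtain ⟨a, σ, ha, hga⟩ := hsemi g hg
    exact ⟨⟨Units.mk0 a ha, σ⟩, Equiv.ext fun x => (hga x).symm⟩
  have hmap : (G₀.comap Φ).map Φ = G₀ := Subgroup.map_comap_eq_self hrange
  have hcover {x z : F} (hg : ∃ g ∈ G₀, g x = z) : ∃ γ ∈ G₀.comap Φ, Φ γ x = z := by
    obtain ⟨g, hg, hgx⟩ := hg
    obtain ⟨γ, rfl⟩ := hrange g hg
    exact ⟨γ, hg, hgx⟩
  have hmem : inl (-1) ∈ G₀.comap Φ := by
    rcases horb with h | ⟨hev, x, y, hx, hy, -, h⟩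
    · exact inl_neg_one_mem_of_orbits hp hodd (by omega) hcard (fun _ : Unit => 1)
        (fun z => ⟨(), hcover (h _ _ one_ne_zero z.ne_zero)⟩) (Or.inl (by simp))
    · refine inl_neg_one_mem_of_orbits hp hodd (by omega) hcard
        (fun b : Bool => if b then Units.mk0 x hx else Units.mk0 y hy) (fun z => ?_)
        (Or.inr ⟨by simp, ?_⟩)
      · rcases h z z.ne_zero with hz | hz
        · exact ⟨true, hcover hz⟩
        · exact ⟨false, hcover hz⟩
      · rw [even_iff_two_dvd] at hev ⊢
        rw [← hmap] at hev
        exact hev.trans (Subgroup.card_map_dvd _ _)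
  have hneg : Φ (inl (-1)) = Equiv.neg F := by
    ext x
    simp [Φ, SemilinearGroup.toPerm_apply]
  exact hneg ▸ hmem
end

section
/- Let q be a power of a prime p, let F be a finite field, and let φ : F → M_2(F_q) be an injective unital ring homomorphism, so that H := φ(F)^× = φ(F^×) is a cyclic subgroup of GL_2(q). Let h be a generator of H and let ε be an eigenvalue of h in an algebraic closure of F_q (a root of the characteristic polynomial of h). Then ε has multiplicative order |F| − 1; consequently F is isomorphic to the subfield K := F_p(ε) of the algebraic closure, and exactly one of the following holds, where E := K ∩ F_q: (i) ε ∈ F_q, and h is conjugate in GL_2(q) to the diagonal matrix diag(ε, ε^τ) for some field automorphism τ of K; (ii) ε ∉ F_q, [K : E] = 2, and h is conjugate in GL_2(q) to the matrix, with respect to the E-basis {1, ε} of K, of the E-linear map of K given by multiplication by ε (equivalently, to the matrix with rows (0, 1) and (a, b), where X² − bX − a ∈ E[X] is the minimal polynomial of ε over E). -/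
open Matrix in
/-- If every nonzero element of `F` is a power of `x`, then an eigenvalue of `Φ x` is the value
at `x` of a ring homomorphism, recording the action of `F` on an eigenvector. -/
theorem exists_ringHom_apply_eq_of_det_eq_zero {F L n : Type*} [Field F] [Field L]
    [Fintype n] [DecidableEq n] (Φ : F →+* Matrix n n L) {x : F}
    (hgen : ∀ y : F, y ≠ 0 → ∃ m : ℕ, y = x ^ m) {ε : L}
    (hdet : (Φ x - scalar n ε).det = 0) : ∃ ψ : F →+* L, ψ x = ε := by
  obtain ⟨v, hv, hv0⟩ := exists_mulVec_eq_zero_iff.mpr hdet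
  have hx : Φ x *ᵥ v = ε • v := by
    rw [sub_mulVec, sub_eq_zero] at hv0
    rw [hv0]
    ext i
    simp [scalar_apply, mulVec_diagonal]
  have huniq : ∀ {c d : L}, c • v = d • v → c = d := fun h => smul_left_injective L hv h
  have hex : ∀ y : F, ∃ c : L, Φ y *ᵥ v = c • v := by
    intro y
    rcases eq_or_ne y 0 with rfl | hy
    · exact ⟨0, by simp⟩
    · obtain ⟨m, rfl⟩ := hgen y hy
      refine ⟨ε ^ m, ?_⟩
      induction m with
      | zero => simp
      | succ m ih =>
        have ih' : Φ (x ^ m) *ᵥ v = ε ^ m • v := by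
          rcases eq_or_ne (x ^ m) 0 with h | h
          · exact absurd (by rw [pow_succ, h, zero_mul]) hy
          · exact ih h
        rw [pow_succ, map_mul, ← mulVec_mulVec, hx, mulVec_smul, ih', smul_smul, pow_succ,
          mul_comm]
  choose c hc using hex
  refine ⟨{ toFun := c, map_one' := ?_, map_mul' := ?_, map_zero' := ?_, map_add' := ?_ }, ?_⟩
  · exact huniq (by rw [← hc]; simp)
  · intro y z
    exact huniq (by
      rw [← hc, map_mul, ← mulVec_mulVec, hc, mulVec_smul, hc, smul_smul, mul_comm])
  · exact huniq (by rw [← hc]; simp)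
  · intro y z
    exact huniq (by rw [← hc, map_add, add_mulVec, hc, hc, add_smul])
  · exact huniq ((hc x).symm.trans hx)

/-- Two embeddings of a finite field into a field have the same image. -/
theorem RingHom.fieldRange_eq_of_finite {F L : Type*} [Field F] [_root_.Finite F] [Field L]
    (ψ₁ ψ₂ : F →+* L) : ψ₁.fieldRange = ψ₂.fieldRange := by
  classical
  have := Fintype.ofFinite F
  have hne : (Polynomial.X ^ Fintype.card F - Polynomial.X : Polynomial L) ≠ 0 :=
    FiniteField.X_pow_card_sub_X_ne_zero L Fintype.one_lt_card
  have key : ∀ ψ : F →+* L, Finset.univ.image ψ =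
      (Polynomial.X ^ Fintype.card F - Polynomial.X : Polynomial L).roots.toFinset := by
    intro ψ
    apply Finset.eq_of_subset_of_card_le
    · intro y hy
      obtain ⟨z, -, rfl⟩ := Finset.mem_image.mp hy
      simp [hne, Polynomial.IsRoot, ← map_pow, FiniteField.pow_card]
    · rw [Finset.card_image_of_injective _ ψ.injective, Finset.card_univ]
      refine (Multiset.toFinset_card_le _).trans ((Polynomial.card_roots' _).trans ?_)
      rw [FiniteField.X_pow_card_sub_X_natDegree_eq L Fintype.one_lt_card]
  have himage := (key ψ₁).trans (key ψ₂).symm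
  ext y
  have hy := Finset.ext_iff.mp himage y
  simpa using hy

/-- A ring homomorphism from a field whose nonzero elements are powers of `x` has image
generated by the image of `x`. -/
theorem RingHom.fieldRange_eq_closure_singleton {F L : Type*} [Field F] [Field L] {x : F}
    (hgen : ∀ y : F, y ≠ 0 → ∃ m : ℕ, y = x ^ m) (ψ : F →+* L) :
    ψ.fieldRange = Subfield.closure {ψ x} := by
  apply le_antisymm
  · rintro _ ⟨y, rfl⟩
    rcases eq_or_ne y 0 with rfl | hy
    · simp
    · obtain ⟨m, rfl⟩ := hgen y hy
      rw [map_pow]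
      exact pow_mem (Subfield.subset_closure (Set.mem_singleton (ψ x))) m
  · rw [Subfield.closure_le, Set.singleton_subset_iff]
    exact ⟨x, rfl⟩

/-- If `ε ∉ E` satisfies a quadratic equation over `E`, and every nonzero element of `K ⊇ E` is a
power of `ε`, then `K` has degree `2` over `E`. -/
theorem Subfield.natCard_eq_sq_of_sq_eq {L : Type*} [Field L] {K E : Subfield L} (hEK : E ≤ K)
    {ε a b : L} (hεK : ε ∈ K) (hεE : ε ∉ E) (ha : a ∈ E) (hb : b ∈ E) (hab : ε ^ 2 = b * ε + a)
    (hK : ∀ y ∈ K, y ≠ 0 → ∃ m : ℕ, y = ε ^ m) : Nat.card K = Nat.card E ^ 2 := by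
  have hpow : ∀ m : ℕ, ∃ u ∈ E, ∃ v ∈ E, u + v * ε = ε ^ m := by
    intro m
    induction m with
    | zero => exact ⟨1, one_mem _, 0, zero_mem _, by simp⟩
    | succ m ih =>
      obtain ⟨u, hu, v, hv, h⟩ := ih
      exact ⟨v * a, mul_mem hv ha, u + v * b, add_mem hu (mul_mem hv hb), by
        rw [pow_succ, ← h]; linear_combination -v * hab⟩
  let f : E × E → K := fun z => ⟨z.1 + z.2 * ε,
    add_mem (hEK z.1.2) (mul_mem (hEK z.2.2) hεK)⟩
  have hf : Function.Bijective f := by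
    constructor
    · rintro ⟨⟨u, hu⟩, v, hv⟩ ⟨⟨u', hu'⟩, v', hv'⟩ h
      have h' : u + v * ε = u' + v' * ε := congrArg Subtype.val h
      have hvv : v = v' := by
        by_contra hne
        refine hεE ?_
        have : ε = (u' - u) / (v - v') := by
          rw [eq_div_iff (sub_ne_zero.mpr hne)]
          linear_combination h'
        rw [this]
        exact div_mem (sub_mem hu' hu) (sub_mem hv hv')
      subst hvv
      have huu : u = u' := add_right_cancel h'
      subst huu
      rfl
    · rintro ⟨y, hy⟩
      rcases eq_or_ne y 0 with rfl | hy0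
      · exact ⟨(0, 0), by simp [f]⟩
      · obtain ⟨m, rfl⟩ := hK y hy hy0
        obtain ⟨u, hu, v, hv, h⟩ := hpow m
        exact ⟨(⟨u, hu⟩, ⟨v, hv⟩), Subtype.ext h⟩
  rw [← Nat.card_eq_of_bijective f hf, Nat.card_prod, sq]

namespace Matrix

/-- A matrix `A` such that `A * P = P * D` for some invertible `P` is conjugate to `D`. -/
theorem exists_conj_of_mul_eq {k n : Type*} [Field k] [Fintype n] [DecidableEq n]
    {A D P : Matrix n n k} (hP : P.det ≠ 0) (h : A * P = P * D) :
    ∃ Q : GL n k, (↑Q⁻¹ : Matrix n n k) * A * (↑Q : Matrix n n k) = D := by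
  refine ⟨GeneralLinearGroup.mkOfDetNeZero P hP, ?_⟩
  rw [mul_assoc]
  have hQ : ((GeneralLinearGroup.mkOfDetNeZero P hP : GL n k) : Matrix n n k) = P := rfl
  rw [Units.inv_mul_eq_iff_eq_mul, hQ, h]

/-- The characteristic equation of a `2 × 2` matrix, as the vanishing of a determinant. -/
theorem det_sub_scalar_fin_two {k : Type*} [CommRing k] (A : Matrix (Fin 2) (Fin 2) k) (c : k) :
    (A - scalar (Fin 2) c).det = c ^ 2 - A.trace * c + A.det := by
  simp [det_fin_two, trace_fin_two]
  ring

/-- A `2 × 2` matrix with two distinct eigenvalues is diagonalizable. -/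
theorem exists_conj_diagonal_of_ne {k : Type*} [Field k] {A : Matrix (Fin 2) (Fin 2) k}
    {c d : k} (hcd : c ≠ d) (hc : (A - scalar (Fin 2) c).det = 0)
    (hd : (A - scalar (Fin 2) d).det = 0) :
    ∃ Q : GL (Fin 2) k, (↑Q⁻¹ : Matrix (Fin 2) (Fin 2) k) * A *
      (↑Q : Matrix (Fin 2) (Fin 2) k) = diagonal ![c, d] := by
  obtain ⟨v, hv, hv0⟩ := exists_mulVec_eq_zero_iff.mpr hc
  obtain ⟨w, hw, hw0⟩ := exists_mulVec_eq_zero_iff.mpr hd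
  simp only [funext_iff, Fin.forall_fin_two, mulVec, dotProduct, Fin.sum_univ_two, ne_eq,
    Pi.zero_apply, sub_apply, scalar_apply, diagonal_apply_eq, not_and_or,
    diagonal_apply_ne _ zero_ne_one, diagonal_apply_ne _ one_ne_zero, sub_zero]
    at hv hv0 hw hw0
  obtain ⟨hv0, hv1⟩ := hv0
  obtain ⟨hw0, hw1⟩ := hw0
  refine exists_conj_of_mul_eq (P := !![v 0, w 0; v 1, w 1]) ?_ ?_
  · rw [det_fin_two_of]
    intro h
    have key0 : (c - d) * (v 0 * w 0) = 0 := by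
      linear_combination -hv0 * w 0 + v 0 * hw0 - A 0 1 * h
    have key1 : (c - d) * (v 1 * w 1) = 0 := by
      linear_combination -hv1 * w 1 + v 1 * hw1 + A 1 0 * h
    have key2 : (c - d) * (v 0 * w 1) = 0 := by
      linear_combination -hv0 * w 1 + v 1 * hw0 + (A 0 0 - d) * h
    have key3 : (c - d) * (v 1 * w 0) = 0 := by
      linear_combination key2 - (c - d) * h
    have hne := sub_ne_zero.mpr hcd
    simp only [mul_eq_zero, hne, false_or] at key0 key1 key2 key3
    tauto
  · ext i j
    fin_cases i <;> fin_cases j <;> simp [mul_apply, Fin.sum_univ_two]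
    · linear_combination hv0
    · linear_combination hw0
    · linear_combination hv1
    · linear_combination hw1

/-- A `2 × 2` matrix with a double eigenvalue `c`, satisfying `A ^ n = A` and `c ^ n = c` with
`n = 0` in the base field, is scalar. -/
theorem eq_diagonal_of_pow_eq {k : Type*} [Field k] {A : Matrix (Fin 2) (Fin 2) k}
    {c : k} (htr : A.trace = c + c) (hdet : A.det = c * c) {n : ℕ} (hn : (n : k) = 0)
    (hA : A ^ n = A) (hc : c ^ n = c) : A = diagonal ![c, c] := by
  have hsq : A * A = (2 * c) • A - (c * c) • 1 := by
    rw [trace_fin_two] at htr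
    rw [det_fin_two] at hdet
    ext i j
    fin_cases i <;> fin_cases j <;> simp [mul_apply, Fin.sum_univ_two]
    · linear_combination A 0 0 * htr - hdet
    · linear_combination A 0 1 * htr
    · linear_combination A 1 0 * htr
    · linear_combination A 1 1 * htr - hdet
  have hpow : ∀ m : ℕ, c • A ^ m = (m * c ^ m) • A + (c ^ (m + 1) - m * c ^ (m + 1)) • 1 := by
    intro m
    induction m with
    | zero => simp
    | succ m ih =>
      rw [pow_succ, ← smul_mul_assoc, ih, add_mul, smul_mul_assoc, smul_mul_assoc, hsq, one_mul]
      push_cast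
      module
  rcases eq_or_ne c 0 with rfl | hc0
  · have hsq0 : A * A = 0 := by simpa using hsq
    have hA0 : A = 0 := by
      rcases n with _ | _ | n
      · simp at hc
      · simp at hn
      · rw [← hA, pow_succ, pow_succ, mul_assoc, hsq0, mul_zero]
    rw [hA0]
    ext i j
    fin_cases i <;> fin_cases j <;> simp
  · have h := hpow n
    rw [hA, hn, pow_succ, hc] at h
    simp only [zero_mul, zero_smul, sub_zero, zero_add, mul_smul] at h
    have h' := smul_right_injective _ hc0 h
    rw [h']
    ext i j
    fin_cases i <;> fin_cases j <;> simp

/-- A `2 × 2` matrix with nonzero lower left entry is conjugate to a companion matrix. -/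
theorem exists_conj_companion_fin_two {k : Type*} [Field k] {A : Matrix (Fin 2) (Fin 2) k}
    (hA : A 1 0 ≠ 0) :
    ∃ Q : GL (Fin 2) k, (↑Q⁻¹ : Matrix (Fin 2) (Fin 2) k) * A *
      (↑Q : Matrix (Fin 2) (Fin 2) k) = !![0, 1; -A.det, A.trace] := by
  refine exists_conj_of_mul_eq (P := !![-A 1 1, 1; A 1 0, 0]) ?_ ?_
  · simpa [det_fin_two_of] using hA
  · ext i j
    fin_cases i <;> fin_cases j <;>
      simp [mul_apply, Fin.sum_univ_two, trace_fin_two, det_fin_two] <;> ring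

end Matrix

/-- **Lemma 13.4.** Let `φ : F → M₂(F_q)` be an injective unital ring homomorphism from a
finite field `F`, let `h = φ(x)` for a generator `x` of `F^×`, and let `ε` be an
eigenvalue of `h` in an algebraic closure of `F_q`.  Then `ε` has multiplicative order
`|F| - 1`, `F` is isomorphic to `K := F_p(ε)`, and exactly one of: (i) `ε ∈ F_q` and `h`
is conjugate in `GL₂(q)` to `diag(ε, ε^τ)` for a field automorphism `τ` of `K`; (ii)
`ε ∉ F_q`, `[K : E] = 2` where `E = K ∩ F_q`, and `h` is conjugate in `GL₂(q)` to the
companion matrix `!![0, 1; a, b]` of the minimal polynomial `X² - bX - a` of `ε` over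
`E`. -/
theorem field_embedding_in_matrices
    (p k : ℕ) (hp : p.Prime) (hk : 1 ≤ k)
    (Fq : Type*) [Field Fq] [Fintype Fq] (hcard : Fintype.card Fq = p ^ k)
    (F : Type*) [Field F] [Fintype F]
    (φ : F →+* Matrix (Fin 2) (Fin 2) Fq) (hφ : Function.Injective φ)
    (x : F) (hx0 : x ≠ 0) (hxgen : ∀ y : F, y ≠ 0 → ∃ m : ℕ, y = x ^ m)
    (ε : AlgebraicClosure Fq)
    (hε : Polynomial.aeval ε (Matrix.charpoly (φ x)) = 0) :
    orderOf ε = Fintype.card F - 1 ∧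
    Nonempty (F ≃+* ↥(Subfield.closure ({ε} : Set (AlgebraicClosure Fq)))) ∧
    Xor'
      (∃ (e₀ e₁ : Fq)
        (τ : ↥(Subfield.closure ({ε} : Set (AlgebraicClosure Fq))) ≃+*
             ↥(Subfield.closure ({ε} : Set (AlgebraicClosure Fq)))),
        algebraMap Fq (AlgebraicClosure Fq) e₀ = ε ∧
        algebraMap Fq (AlgebraicClosure Fq) e₁ =
          ↑(τ ⟨ε, Subfield.subset_closure (Set.mem_singleton ε)⟩) ∧
        ∃ P : GL (Fin 2) Fq,
          (↑P⁻¹ : Matrix (Fin 2) (Fin 2) Fq) * φ x * (↑P : Matrix (Fin 2) (Fin 2) Fq) = Matrix.diagonal ![e₀, e₁])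
      ((¬ ∃ c : Fq, algebraMap Fq (AlgebraicClosure Fq) c = ε) ∧
        Nat.card ↥(Subfield.closure ({ε} : Set (AlgebraicClosure Fq))) =
          Nat.card ↥(Subfield.closure ({ε} : Set (AlgebraicClosure Fq)) ⊓
            (algebraMap Fq (AlgebraicClosure Fq)).fieldRange) ^ 2 ∧
        ∃ a b : Fq,
          algebraMap Fq (AlgebraicClosure Fq) a ∈
            Subfield.closure ({ε} : Set (AlgebraicClosure Fq)) ∧
          algebraMap Fq (AlgebraicClosure Fq) b ∈
            Subfield.closure ({ε} : Set (AlgebraicClosure Fq)) ∧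
          ε ^ 2 = algebraMap Fq (AlgebraicClosure Fq) b * ε +
            algebraMap Fq (AlgebraicClosure Fq) a ∧
          ∃ P : GL (Fin 2) Fq,
            (↑P⁻¹ : Matrix (Fin 2) (Fin 2) Fq) * φ x * (↑P : Matrix (Fin 2) (Fin 2) Fq) = !![0, 1; a, b]) := by
  set ι := algebraMap Fq (AlgebraicClosure Fq) with hι
  have hιinj : Function.Injective ι := ι.injective
  set A := φ x with hA
  set Φ : F →+* Matrix (Fin 2) (Fin 2) (AlgebraicClosure Fq) := ι.mapMatrix.comp φ with hΦ
  have hchar : ∀ c, (Φ x - Matrix.scalar (Fin 2) c).det = c ^ 2 - ι A.trace * c + ι A.det := by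
    intro c
    rw [Matrix.det_sub_scalar_fin_two]
    simp [hΦ, ← hA, Matrix.trace_fin_two, Matrix.det_fin_two]
  have hroot : ε ^ 2 - ι A.trace * ε + ι A.det = 0 := by
    simpa [Matrix.charpoly_fin_two] using hε
  obtain ⟨ψ, hψ⟩ := exists_ringHom_apply_eq_of_det_eq_zero Φ hxgen ((hchar ε).trans hroot)
  obtain ⟨ψ', hψ'⟩ := exists_ringHom_apply_eq_of_det_eq_zero Φ hxgen
    ((hchar (ι A.trace - ε)).trans (by linear_combination hroot))
  have hK : ψ.fieldRange = Subfield.closure {ε} := by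
    rw [ψ.fieldRange_eq_closure_singleton hxgen, hψ]
  have hK' : ψ'.fieldRange = Subfield.closure {ε} :=
    (ψ'.fieldRange_eq_of_finite ψ).trans hK
  let e : F ≃+* Subfield.closure ({ε} : Set (AlgebraicClosure Fq)) :=
    ψ.rangeRestrictFieldEquiv.trans (RingEquiv.subfieldCongr hK)
  let e' : F ≃+* Subfield.closure ({ε} : Set (AlgebraicClosure Fq)) :=
    ψ'.rangeRestrictFieldEquiv.trans (RingEquiv.subfieldCongr hK')
  have he : e x = ⟨ε, Subfield.subset_closure (Set.mem_singleton ε)⟩ := Subtype.ext hψ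
  have he' : ((e' x : Subfield.closure {ε}) : AlgebraicClosure Fq) = ι A.trace - ε := hψ'
  refine ⟨?_, ⟨e⟩, ?_⟩
  · have hψx : orderOf (ψ x) = orderOf (Units.mk0 x hx0) :=
      (orderOf_injective ψ.toMonoidHom ψ.injective x).trans
        (orderOf_units (y := Units.mk0 x hx0))
    rw [← hψ, hψx, orderOf_eq_card_of_forall_mem_zpowers, Nat.card_units,
      Nat.card_eq_fintype_card]
    intro y
    obtain ⟨m, hm⟩ := hxgen y y.ne_zero
    exact ⟨m, Units.ext (by simp [hm])⟩
  by_cases h : ∃ c : Fq, ι c = ε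
  · refine Or.inl ⟨?_, fun h' => h'.1 h⟩
    obtain ⟨c, rfl⟩ := h
    have hc : (A - Matrix.scalar (Fin 2) c).det = 0 := by
      rw [Matrix.det_sub_scalar_fin_two]
      apply hιinj
      simpa using hroot
    have hd : (A - Matrix.scalar (Fin 2) (A.trace - c)).det = 0 := by
      rw [Matrix.det_sub_scalar_fin_two] at hc ⊢
      linear_combination hc
    refine ⟨c, A.trace - c, e.symm.trans e', rfl, ?_, ?_⟩
    · rw [← he, RingEquiv.trans_apply, e.symm_apply_apply, he', map_sub]
    rcases eq_or_ne c (A.trace - c) with hcd | hcd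
    · have htr : A.trace = c + c := by linear_combination -hcd
      refine ⟨1, ?_⟩
      rw [← hcd, inv_one, Units.val_one, one_mul, mul_one]
      refine Matrix.eq_diagonal_of_pow_eq (n := Fintype.card F) htr ?_ ?_ ?_ ?_
      · rw [Matrix.det_sub_scalar_fin_two, htr] at hc
        linear_combination hc
      · apply hιinj
        rw [map_natCast, map_zero, ← map_natCast ψ, FiniteField.cast_card_eq_zero, map_zero]
      · rw [hA, ← map_pow, FiniteField.pow_card]
      · apply hιinj
        rw [map_pow, ← hψ, ← map_pow, FiniteField.pow_card]
    · exact Matrix.exists_conj_diagonal_of_ne hcd hc hd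
  · have hεK : ε ∈ Subfield.closure ({ε} : Set (AlgebraicClosure Fq)) :=
      Subfield.subset_closure (Set.mem_singleton ε)
    have hεK' : ι A.trace - ε ∈ Subfield.closure ({ε} : Set (AlgebraicClosure Fq)) :=
      he' ▸ (e' x).2
    have htr : ι A.trace ∈ Subfield.closure ({ε} : Set (AlgebraicClosure Fq)) := by
      simpa using add_mem hεK' hεK
    have hdet : ι (-A.det) ∈ Subfield.closure ({ε} : Set (AlgebraicClosure Fq)) := by
      have hmul : ι (-A.det) = -(ε * (ι A.trace - ε)) := by
        rw [map_neg]
        linear_combination -hroot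
      rw [hmul]
      exact neg_mem (mul_mem hεK hεK')
    have hsq : ε ^ 2 = ι A.trace * ε + ι (-A.det) := by
      rw [map_neg]
      linear_combination hroot
    refine Or.inr ⟨⟨h, ?_, -A.det, A.trace, hdet, htr, hsq, ?_⟩,
      fun ⟨c, _, _, hc, _⟩ => h ⟨c, hc⟩⟩
    · refine Subfield.natCard_eq_sq_of_sq_eq inf_le_left hεK (fun hmem => h hmem.2)
        (Subfield.mem_inf.mpr ⟨hdet, _, rfl⟩) (Subfield.mem_inf.mpr ⟨htr, _, rfl⟩) hsq ?_
      intro y hy hy0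
      rw [← hK] at hy
      obtain ⟨z, rfl⟩ := hy
      obtain ⟨m, rfl⟩ := hxgen z (fun hz => hy0 (by rw [hz, map_zero]))
      exact ⟨m, by rw [map_pow, hψ]⟩
    · refine Matrix.exists_conj_companion_fin_two fun h10 => h ?_
      have hfactor : (ε - ι (A 0 0)) * (ε - ι (A 1 1)) = 0 := by
        rw [Matrix.trace_fin_two, Matrix.det_fin_two, h10, mul_zero, sub_zero, map_add,
          map_mul] at hroot
        linear_combination hroot
      rcases mul_eq_zero.mp hfactor with h0 | h1
      · exact ⟨_, (sub_eq_zero.mp h0).symm⟩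
      · exact ⟨_, (sub_eq_zero.mp h1).symm⟩
end
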